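/- For every integer d ≥ 2 there exists a compact set A ⊂ ℝ^d such that: (i) ℋ¹(A ∩ Γ) = 0 for every rectifiable curve Γ (i.e. for every Lipschitz image of [0,1] in ℝ^d), so A is purely 1-unrectifiable; (ii) the Hausdorff dimension of A equals d−1, and for every ε > 0 and all sufficiently small r > 0 the set A can be covered by at most r^{-(d-1+ε)} balls of radius r (so the upper box-counting dimension of A is also d−1); and (iii) A is not tube null. -/

import Mathlib

open MeasureTheory Metric Set
open scoped ENNReal NNReal

noncomputable section

/-- `ℝ^d` as Euclidean space. -/
abbrev Pt (d : ℕ) := EuclideanSpace ℝ (Fin d)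

/-- `L` is an affine line in `ℝ^d`. -/
def IsLine {d : ℕ} (L : Set (Pt d)) : Prop :=
  ∃ a v : Pt d, v ≠ 0 ∧ L = {x | ∃ t : ℝ, x = a + t • v}

/-- A tube of width `w` is the closed `w`-neighborhood of an affine line. -/
def IsTube {d : ℕ} (w : ℝ) (T : Set (Pt d)) : Prop :=
  ∃ L : Set (Pt d), IsLine L ∧ T = Metric.cthickening w L

/-- `A ⊆ ℝ^d` is tube null: for every `δ > 0` it is covered by countably many
tubes `T j` of widths `w j` with `∑ j, (w j)^(d-1) ≤ δ`. -/
def TubeNull (d : ℕ) (A : Set (Pt d)) : Prop :=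
  ∀ δ : ℝ, 0 < δ → ∃ (T : ℕ → Set (Pt d)) (w : ℕ → ℝ),
    (∀ n, 0 < w n ∧ IsTube (w n) (T n)) ∧ (A ⊆ ⋃ n, T n) ∧
    ∑' n, ENNReal.ofReal (w n) ^ (d - 1) ≤ ENNReal.ofReal δ

/-- The Hausdorff measure associated to the gauge function `h`. -/
def gMeasure {d : ℕ} (h : ℝ → ℝ) : Measure (Pt d) :=
  Measure.mkMetric (fun r : ℝ≥0∞ => ENNReal.ofReal (h r.toReal))

/-- A finite Chernoff bound: independent uniform choices `ω b` can be made so that finitely many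
sums `∑ b, w j b (ω b)` are all close to (an upper bound for) their means. -/
theorem exists_choice_forall_sum_le {J B P : Type*} [Fintype J] [Fintype B] [Fintype P]
    [Nonempty P] (w : J → B → P → ℝ) {u H κ t : ℝ} (hu : 0 < u) (hκ : 0 < κ) (hκ1 : κ ≤ 1)
    (hw0 : ∀ j b p, 0 ≤ w j b p) (hwu : ∀ j b p, w j b p ≤ u)
    (hH : ∀ j, ∑ b, ∑ p, w j b p ≤ H)
    (hJ : (Fintype.card J : ℝ) * Real.exp (-(κ * t / u)) < 1) :
    ∃ ω : B → P, ∀ j, ∑ b, w j b (ω b) ≤ (1 + κ) * H / Fintype.card P + t := by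
  classical
  by_contra! hcon
  set N : ℝ := ((Fintype.card P : ℕ) : ℝ) with hN
  have hN0 : 0 < N := by rw [hN]; exact_mod_cast Fintype.card_pos
  set T := (1 + κ) * H / N + t with hT
  set l := κ / u with hl
  have hl0 : 0 < l := by positivity
  have key : ∀ j b, ∑ p, Real.exp (l * w j b p) ≤
      N * Real.exp (l * (1 + κ) / N * ∑ p, w j b p) := by
    intro j b
    have h1 : ∀ p, Real.exp (l * w j b p) ≤ 1 + l * (1 + κ) * w j b p := by
      intro p
      have hx0 : 0 ≤ l * w j b p := mul_nonneg hl0.le (hw0 j b p)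
      have hxk : l * w j b p ≤ κ := by
        calc l * w j b p ≤ l * u := by gcongr; exact hwu j b p
          _ = κ := by rw [hl]; field_simp
      have h := Real.abs_exp_sub_one_sub_id_le (x := l * w j b p)
        (by rw [abs_of_nonneg hx0]; linarith)
      have := (abs_le.1 h).2
      nlinarith
    calc ∑ p, Real.exp (l * w j b p) ≤ ∑ p, (1 + l * (1 + κ) * w j b p) :=
          Finset.sum_le_sum fun p _ => h1 p
      _ = N * (l * (1 + κ) / N * ∑ p, w j b p + 1) := by
          rw [Finset.sum_add_distrib, ← Finset.mul_sum]
          simp only [Finset.sum_const, Finset.card_univ, nsmul_eq_mul, mul_one, ← hN]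
          field_simp
          ring
      _ ≤ _ := by gcongr; exact Real.add_one_le_exp _
  have h2 : ∀ j, ∑ ω : B → P, Real.exp (l * (∑ b, w j b (ω b) - T)) ≤
      N ^ Fintype.card B * Real.exp (-(κ * t / u)) := by
    intro j
    calc ∑ ω : B → P, Real.exp (l * (∑ b, w j b (ω b) - T))
        = Real.exp (-(l * T)) * ∑ ω : B → P, ∏ b, Real.exp (l * w j b (ω b)) := by
          rw [Finset.mul_sum]
          refine Finset.sum_congr rfl fun ω _ => ?_
          rw [← Real.exp_sum, ← Real.exp_add, ← Finset.mul_sum]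
          congr 1; ring
      _ = Real.exp (-(l * T)) * ∏ b, ∑ p, Real.exp (l * w j b p) := by
          rw [Finset.prod_univ_sum, Fintype.piFinset_univ]
      _ ≤ Real.exp (-(l * T)) * ∏ b, (N * Real.exp (l * (1 + κ) / N * ∑ p, w j b p)) := by
          gcongr with b
          exact key j b
      _ = N ^ Fintype.card B * Real.exp (-(l * T) + l * (1 + κ) / N * ∑ b, ∑ p, w j b p) := by
          rw [Finset.prod_mul_distrib, ← Real.exp_sum, ← Finset.mul_sum, Real.exp_add]
          simp only [Finset.prod_const, Finset.card_univ]
          ring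
      _ ≤ N ^ Fintype.card B * Real.exp (-(κ * t / u)) := by
          gcongr
          calc -(l * T) + l * (1 + κ) / N * ∑ b, ∑ p, w j b p
              ≤ -(l * T) + l * (1 + κ) / N * H := by gcongr; exact hH j
            _ = _ := by rw [hT, hl]; field_simp; ring
  have h3 : N ^ Fintype.card B ≤
      ∑ ω : B → P, ∑ j, Real.exp (l * (∑ b, w j b (ω b) - T)) := by
    calc N ^ Fintype.card B = ∑ ω : B → P, (1 : ℝ) := by simp [hN]
      _ ≤ _ := by
        refine Finset.sum_le_sum fun ω _ => ?_
        obtain ⟨j, hj⟩ := hcon ω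
        calc (1 : ℝ) ≤ Real.exp (l * (∑ b, w j b (ω b) - T)) := by
              rw [← Real.exp_zero]
              exact Real.exp_le_exp.2 (mul_nonneg hl0.le (by linarith))
          _ ≤ _ := Finset.single_le_sum
              (f := fun j => Real.exp (l * (∑ b, w j b (ω b) - T)))
              (fun _ _ => (Real.exp_pos _).le) (Finset.mem_univ j)
  rw [Finset.sum_comm] at h3
  have h4 := h3.trans (Finset.sum_le_sum fun j _ => h2 j)
  simp only [Finset.sum_const, Finset.card_univ, nsmul_eq_mul] at h4
  have h5 : 0 < N ^ Fintype.card B := by positivity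
  nlinarith

/-- A Lipschitz map of the line sends a set on which its derivative vanishes to an `ℋ¹`-null set. -/
theorem hausdorffMeasure_image_eq_zero_of_hasDerivAt_zero {E : Type*} [NormedAddCommGroup E]
    [NormedSpace ℝ E] [MeasurableSpace E] [BorelSpace E] {f : ℝ → E} {s : Set ℝ}
    (hs : s ⊆ Icc 0 1) (hf : ∀ t ∈ s, HasDerivAt f 0 t) : μH[1] (f '' s) = 0 := by
  have main : ∀ ε : ℝ≥0, 0 < ε → μH[1] (f '' s) ≤ 2 * ε := by
    intro ε hε
    set S : ℕ → Set ℝ := fun j =>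
      {t ∈ s | ∀ x, |x - t| ≤ 1 / ((j : ℝ) + 1) → ‖f x - f t‖ ≤ ε * |x - t|} with hS
    have hmono : Monotone S := by
      intro i j hij t ht
      refine ⟨ht.1, fun x hx => ht.2 x (hx.trans ?_)⟩
      gcongr
    have hcov : s = ⋃ j, S j := by
      refine Subset.antisymm (fun t ht => ?_) (iUnion_subset fun j t ht => ht.1)
      have h := (hasDerivAt_iff_isLittleO.1 (hf t ht)).def (c := (ε : ℝ)) (by exact_mod_cast hε)
      obtain ⟨r, hr, h⟩ := Metric.eventually_nhds_iff.1 h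
      obtain ⟨j, hj⟩ := exists_nat_one_div_lt hr
      refine mem_iUnion.2 ⟨j, ht, fun x hx => ?_⟩
      have := h (y := x) (by rw [Real.dist_eq]; exact hx.trans_lt hj)
      simpa [Real.norm_eq_abs] using this
    have hSj : ∀ j, μH[1] (f '' S j) ≤ 2 * ε := by
      intro j
      have hpiece : ∀ k : ℕ,
          μH[1] (f '' (S j ∩ Icc ((k : ℝ) / (j + 1)) ((k + 1 : ℝ) / (j + 1)))) ≤
            ε * ENNReal.ofReal (1 / (j + 1)) := by
        intro k
        have hlip : LipschitzOnWith ε f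
            (S j ∩ Icc ((k : ℝ) / (j + 1)) ((k + 1 : ℝ) / (j + 1))) := by
          refine LipschitzOnWith.of_dist_le_mul fun x hx y hy => ?_
          rw [dist_eq_norm, Real.dist_eq]
          refine hy.1.2 x ?_
          have h1 : ((k + 1 : ℝ) / (j + 1)) = k / (j + 1) + 1 / (j + 1) := by ring
          have := hx.2.1; have := hx.2.2; have := hy.2.1; have := hy.2.2
          rw [abs_le]; constructor <;> linarith
        refine (hlip.hausdorffMeasure_image_le zero_le_one).trans ?_
        rw [ENNReal.rpow_one, hausdorffMeasure_real]
        gcongr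
        refine (measure_mono inter_subset_right).trans ?_
        rw [Real.volume_Icc]
        apply ENNReal.ofReal_le_ofReal
        apply le_of_eq; ring
      have hsub : f '' S j ⊆ ⋃ k ∈ Finset.range (j + 2),
          f '' (S j ∩ Icc ((k : ℝ) / (j + 1)) ((k + 1 : ℝ) / (j + 1))) := by
        rintro _ ⟨t, ht, rfl⟩
        have ht01 := hs ht.1
        have hj0 : (0 : ℝ) < j + 1 := by positivity
        have h0 : 0 ≤ t * (j + 1) := mul_nonneg ht01.1 hj0.le
        refine mem_iUnion₂.2 ⟨⌊t * (j + 1)⌋₊, ?_, t, ⟨ht, ?_, ?_⟩, rfl⟩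
        · rw [Finset.mem_range]
          have : ⌊t * (j + 1)⌋₊ ≤ j + 1 := by
            apply Nat.floor_le_of_le
            push_cast
            nlinarith [ht01.2]
          omega
        · rw [div_le_iff₀ hj0]; exact Nat.floor_le h0
        · rw [le_div_iff₀ hj0]; exact (Nat.lt_floor_add_one _).le
      refine (measure_mono hsub).trans ((measure_biUnion_finset_le _ _).trans
        ((Finset.sum_le_sum fun k _ => hpiece k).trans ?_))
      rw [Finset.sum_const, Finset.card_range, nsmul_eq_mul, mul_comm (2 : ℝ≥0∞), mul_left_comm]
      gcongr
      rw [← ENNReal.ofReal_natCast, ← ENNReal.ofReal_mul (by positivity),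
        show (2 : ℝ≥0∞) = ENNReal.ofReal 2 by norm_num]
      apply ENNReal.ofReal_le_ofReal
      push_cast
      rw [mul_one_div, div_le_iff₀ (by positivity)]
      linarith [(Nat.cast_nonneg j : (0 : ℝ) ≤ j)]
    rw [hcov, image_iUnion, (Monotone.measure_iUnion fun i j hij => image_mono (hmono hij))]
    exact iSup_le hSj
  refine le_antisymm (ENNReal.le_of_forall_pos_le_add fun ε hε _ => ?_) zero_le
  refine (main (ε / 2) (by positivity)).trans ?_
  rw [zero_add, ENNReal.coe_div two_ne_zero, ENNReal.coe_ofNat,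
    ENNReal.mul_div_cancel two_ne_zero ENNReal.ofNat_ne_top]

/-- A set with empty annuli `u < ‖y - x‖ ≤ 2 u` around all of its points, at arbitrarily small
scales `u`, meets every rectifiable curve in an `ℋ¹`-null set. -/
theorem hausdorffMeasure_inter_image_eq_zero_of_annuli {E : Type*} [NormedAddCommGroup E]
    [NormedSpace ℝ E] [FiniteDimensional ℝ E] [MeasurableSpace E] [BorelSpace E] {A : Set E}
    (hcl : IsClosed A)
    (hA : ∀ ε : ℝ, 0 < ε → ∃ u : ℝ, 0 < u ∧ u < ε ∧
      ∀ x ∈ A, ∀ y ∈ A, ‖y - x‖ ≤ 2 * u → ‖y - x‖ ≤ u)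
    {K : ℝ≥0} {f : ℝ → E} (hf : LipschitzWith K f) : μH[1] (A ∩ f '' Icc 0 1) = 0 := by
  set s : Set ℝ := f ⁻¹' A ∩ Icc 0 1 with hs
  have hsm : MeasurableSet s := (hcl.preimage hf.continuous).measurableSet.inter measurableSet_Icc
  have hAs : A ∩ f '' Icc 0 1 = f '' s := by
    rw [hs, image_preimage_inter]
  have key : ∀ᵐ t ∂(volume.restrict s), HasDerivAt f 0 t := by
    filter_upwards [ae_restrict_mem hsm, ae_restrict_of_ae hf.ae_differentiableAt,
      Besicovitch.ae_tendsto_measure_inter_div volume s] with t hts hd hdens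
    have hder := hd.hasDerivAt
    set D := deriv f t with hD
    by_cases hD0 : D = 0
    · rwa [hD0] at hder
    exfalso
    have hM : 0 < ‖D‖ := norm_pos_iff.2 hD0
    obtain ⟨r₁, hr₁, hder⟩ := Metric.eventually_nhds_iff.1
      ((hasDerivAt_iff_isLittleO.1 hder).def (c := ‖D‖ / 10) (by positivity))
    have hev := hdens.eventually (lt_mem_nhds (show ENNReal.ofReal (15 / 17) < 1 by
      rw [← ENNReal.ofReal_one]; exact (ENNReal.ofReal_lt_ofReal_iff one_pos).2 (by norm_num)))
    obtain ⟨r₂, hr₂, hev⟩ := mem_nhdsGT_iff_exists_Ioo_subset.1 hev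
    have hr₂0 : (0 : ℝ) < r₂ := hr₂
    obtain ⟨u, hu, hur, hann⟩ := hA (min r₁ r₂ * ‖D‖ / 2) (by positivity)
    set h := 17 / 10 * u / ‖D‖ with hh
    have hh0 : 0 < h := by positivity
    have huD : u / ‖D‖ < min r₁ r₂ / 2 := by rw [div_lt_iff₀ hM]; linarith
    have hh1 : h < min r₁ r₂ := by
      have : h = 17 / 10 * (u / ‖D‖) := by rw [hh]; ring
      have : 0 < u / ‖D‖ := by positivity
      linarith
    have hball := hev ⟨hh0, hh1.trans_le (min_le_right _ _)⟩
    have hsub : s ∩ closedBall t h ⊆ Icc (t - h) (t + 13 / 17 * h) := by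
      rintro x ⟨hxs, hxb⟩
      rw [mem_closedBall, Real.dist_eq, abs_le] at hxb
      refine ⟨by linarith [hxb.1], ?_⟩
      by_contra! hx
      have hxt : 0 < x - t := by nlinarith
      have h1 := hder (y := x) (by
        rw [Real.dist_eq, abs_of_pos hxt]; exact hxb.2.trans_lt (hh1.trans_le (min_le_left _ _)))
      rw [Real.norm_eq_abs, abs_of_pos hxt] at h1
      have h2 : ‖(x - t) • D‖ = (x - t) * ‖D‖ := by rw [norm_smul, Real.norm_eq_abs, abs_of_pos hxt]
      have hhu : h * ‖D‖ = 17 / 10 * u := by rw [hh]; field_simp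
      have h3 : ‖f x - f t‖ ≤ (x - t) * ‖D‖ + ‖D‖ / 10 * (x - t) := by
        have := norm_add_le (f x - f t - (x - t) • D) ((x - t) • D)
        rw [sub_add_cancel] at this
        linarith
      have h4 : (x - t) * ‖D‖ ≤ ‖f x - f t‖ + ‖D‖ / 10 * (x - t) := by
        have := norm_sub_norm_le ((x - t) • D) (f x - f t)
        rw [norm_sub_rev ((x - t) • D) (f x - f t), h2] at this
        linarith
      have h5 := hann (f t) hts.1 (f x) hxs.1 (by nlinarith)
      nlinarith
    have hle : volume (s ∩ closedBall t h) / volume (closedBall t h) ≤ ENNReal.ofReal (15 / 17) := by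
      rw [Real.volume_closedBall]
      refine ENNReal.div_le_of_le_mul ?_
      refine (measure_mono hsub).trans ?_
      rw [Real.volume_Icc, ← ENNReal.ofReal_mul (by norm_num)]
      apply ENNReal.ofReal_le_ofReal
      apply le_of_eq; ring
    exact absurd hball (not_lt.2 hle)
  have hnull : volume (s ∩ {t | ¬ HasDerivAt f 0 t}) = 0 := by
    rw [ae_restrict_iff' hsm] at key
    refine measure_mono_null ?_ (ae_iff.1 key)
    intro t ht h
    exact ht.2 (h ht.1)
  rw [hAs]
  refine measure_mono_null (t := f '' (s ∩ {t | HasDerivAt f 0 t}) ∪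
    f '' (s ∩ {t | ¬ HasDerivAt f 0 t})) ?_ (measure_union_null ?_ ?_)
  · rw [← image_union, ← inter_union_distrib_left]
    apply image_mono
    intro t ht
    exact ⟨ht, em _⟩
  · exact hausdorffMeasure_image_eq_zero_of_hasDerivAt_zero
      (fun t ht => ht.1.2) fun t ht => ht.2
  · refine le_antisymm ((hf.hausdorffMeasure_image_le zero_le_one _).trans ?_) zero_le
    rw [hausdorffMeasure_real, hnull, mul_zero]

/-- The half-open axis-parallel cube with lowest corner `c` and side `h`. -/
def halfCube {d : ℕ} (c : Fin d → ℝ) (h : ℝ) : Set (Fin d → ℝ) :=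
  {x | ∀ i, c i ≤ x i ∧ x i < c i + h}

/-- The closed axis-parallel cube with lowest corner `c` and side `h`. -/
def closedCube {d : ℕ} (c : Fin d → ℝ) (h : ℝ) : Set (Fin d → ℝ) :=
  {x | ∀ i, c i ≤ x i ∧ x i ≤ c i + h}

/-- The union of the closed cubes of side `h` with lowest corners in `C`. -/
def cubeUnion {d : ℕ} (C : Finset (Fin d → ℝ)) (h : ℝ) : Set (Fin d → ℝ) :=
  ⋃ c ∈ C, closedCube c h

theorem mem_cubeUnion {d : ℕ} {C : Finset (Fin d → ℝ)} {h : ℝ} {x : Fin d → ℝ} :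
    x ∈ cubeUnion C h ↔ ∃ c ∈ C, x ∈ closedCube c h := by
  simp [cubeUnion]

theorem halfCube_subset_closedCube {d : ℕ} (c : Fin d → ℝ) (h : ℝ) :
    halfCube c h ⊆ closedCube c h := fun _ hx i => ⟨(hx i).1, (hx i).2.le⟩

theorem closedCube_eq_pi {d : ℕ} (c : Fin d → ℝ) (h : ℝ) :
    closedCube c h = Set.pi univ fun i => Icc (c i) (c i + h) := by
  ext x; simp only [closedCube, mem_ofPred_eq, Set.mem_pi, mem_univ, true_imp_iff, mem_Icc]

theorem halfCube_eq_pi {d : ℕ} (c : Fin d → ℝ) (h : ℝ) :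
    halfCube c h = Set.pi univ fun i => Ico (c i) (c i + h) := by
  ext x; simp [halfCube]

theorem isCompact_closedCube {d : ℕ} (c : Fin d → ℝ) (h : ℝ) : IsCompact (closedCube c h) := by
  rw [closedCube_eq_pi]
  exact isCompact_univ_pi fun i => isCompact_Icc

theorem isCompact_cubeUnion {d : ℕ} (C : Finset (Fin d → ℝ)) (h : ℝ) :
    IsCompact (cubeUnion C h) :=
  C.isCompact_biUnion fun c _ => isCompact_closedCube c h

theorem measurableSet_halfCube {d : ℕ} (c : Fin d → ℝ) (h : ℝ) :
    MeasurableSet (halfCube c h) := by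
  rw [halfCube_eq_pi]
  exact MeasurableSet.univ_pi fun i => measurableSet_Ico

theorem volume_closedCube {d : ℕ} (c : Fin d → ℝ) {h : ℝ} :
    volume (closedCube c h) = ENNReal.ofReal h ^ d := by
  rw [closedCube_eq_pi, volume_pi_pi]
  simp

theorem norm_sub_le_of_mem_closedCube {d : ℕ} {c x y : Fin d → ℝ} {h : ℝ} (hh : 0 ≤ h)
    (hx : x ∈ closedCube c h) (hy : y ∈ closedCube c h) : ‖y - x‖ ≤ h := by
  refine (pi_norm_le_iff_of_nonneg hh).2 fun i => ?_
  rw [Pi.sub_apply, Real.norm_eq_abs, abs_le]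
  have := hx i; have := hy i
  constructor <;> linarith [(hx i).1, (hx i).2, (hy i).1, (hy i).2]

/-- Cubes of a grid are disjoint. -/
theorem eq_of_mem_halfCube_grid {d : ℕ} {c x : Fin d → ℝ} {h : ℝ} (hh : 0 < h) {b b' : Fin d → ℕ}
    (hb : x ∈ halfCube (fun i => c i + b i * h) h) (hb' : x ∈ halfCube (fun i => c i + b' i * h) h) :
    b = b' := by
  have aux : ∀ {m n : ℕ} {y z : ℝ}, y + m * h ≤ z → z < y + n * h + h → m ≤ n := by
    intro m n y z h1 h2
    have h3 : (m : ℝ) < n + 1 := by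
      by_contra! hcon
      nlinarith
    exact_mod_cast Nat.lt_succ_iff.1 (by exact_mod_cast h3)
  funext i
  exact le_antisymm (aux (hb i).1 (hb' i).2) (aux (hb' i).1 (hb i).2)

theorem exists_abs_apply_eq_one {d : ℕ} {v : Fin d → ℝ} (hv : ‖v‖ = 1) : ∃ i, |v i| = 1 := by
  by_contra! hcon
  have : ‖v‖ < 1 := (pi_norm_lt_iff one_pos).2 fun i =>
    lt_of_le_of_ne (hv ▸ norm_le_pi_norm v i) (hcon i)
  exact this.ne hv

/-- The parameters at which the line `t ↦ a + t v` is in `E`. -/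
def lineTrace {d : ℕ} (a v : Fin d → ℝ) (E : Set (Fin d → ℝ)) : Set ℝ :=
  {t | a + t • v ∈ E}

theorem measurableSet_lineTrace {d : ℕ} (a v : Fin d → ℝ) {E : Set (Fin d → ℝ)}
    (hE : MeasurableSet E) : MeasurableSet (lineTrace a v E) :=
  measurableSet_preimage (by fun_prop : Measurable fun t : ℝ => a + t • v) hE

theorem volume_lineTrace_closedCube_le {d : ℕ} (a c : Fin d → ℝ) {v : Fin d → ℝ} (hv : ‖v‖ = 1)
    (h : ℝ) : volume (lineTrace a v (closedCube c h)) ≤ ENNReal.ofReal h := by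
  obtain ⟨i, hi⟩ := exists_abs_apply_eq_one hv
  have hsq : v i * v i = 1 := by rw [← abs_mul_abs_self, hi, one_mul]
  rcases (abs_eq zero_le_one).1 hi with h1 | h1
  · refine (measure_mono (t := Icc (c i - a i) (c i - a i + h)) fun t ht => ?_).trans ?_
    · have := ht i
      simp only [Pi.add_apply, Pi.smul_apply, smul_eq_mul, h1] at this
      constructor <;> linarith
    · rw [Real.volume_Icc]; apply ENNReal.ofReal_le_ofReal; linarith
  · refine (measure_mono (t := Icc (a i - c i - h) (a i - c i)) fun t ht => ?_).trans ?_
    · have := ht i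
      simp only [Pi.add_apply, Pi.smul_apply, smul_eq_mul, h1] at this
      constructor <;> linarith
    · rw [Real.volume_Icc]; apply ENNReal.ofReal_le_ofReal; linarith

theorem volume_lineTrace_add_smul {d : ℕ} (a v : Fin d → ℝ) (t₀ : ℝ) (E : Set (Fin d → ℝ)) :
    volume (lineTrace (a + t₀ • v) v E) = volume (lineTrace a v E) := by
  have : lineTrace (a + t₀ • v) v E = (fun t => t₀ + t) ⁻¹' lineTrace a v E := by
    ext t
    simp only [lineTrace, mem_ofPred_eq, mem_preimage, add_smul, add_assoc]
  rw [this, measure_preimage_add]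

/-- Points of the unit cube are close to the grid of mesh `1 / m`. -/
theorem exists_grid_point_near {d m : ℕ} (hm : 0 < m) {x : Fin d → ℝ} (hx : x ∈ Icc 0 1) :
    ∃ k : Fin d → Fin (m + 1), ∀ i, |x i - (k i : ℝ) / m| < 1 / m := by
  have hm' : (0 : ℝ) < m := by exact_mod_cast hm
  refine ⟨fun i => ⟨⌊x i * m⌋₊, ?_⟩, fun i => ?_⟩
  · have h1 : x i ≤ 1 := hx.2 i
    exact Nat.lt_succ_of_le (Nat.floor_le_of_le (by nlinarith))
  · have h0 : 0 ≤ x i := hx.1 i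
    have h1 := Nat.floor_le (mul_nonneg h0 hm'.le)
    have h2 := Nat.lt_floor_add_one (x i * m)
    rw [abs_lt]
    have h3 : x i = x i * m / m := by field_simp
    simp only
    have h4 : x i - ((⌊x i * m⌋₊ : ℕ) : ℝ) / m = (x i * m - ((⌊x i * m⌋₊ : ℕ) : ℝ)) / m := by
      rw [sub_div, ← h3]
    rw [h4, ← neg_div]
    constructor
    · apply div_lt_div_of_pos_right _ hm'; linarith
    · apply div_lt_div_of_pos_right _ hm'; linarith

/-- Sup-norm unit vectors are close to unit vectors on the grid of mesh `1 / m`. -/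
theorem exists_grid_direction_near {d m : ℕ} (hm : 0 < m) {v : Fin d → ℝ} (hv : ‖v‖ = 1) :
    ∃ k : Fin d → Fin (2 * m + 1), ‖(fun i => (k i : ℝ) / m - 1 : Fin d → ℝ)‖ = 1 ∧
      ∀ i, |v i - ((k i : ℝ) / m - 1)| ≤ 1 / m := by
  have hm' : (0 : ℝ) < m := by exact_mod_cast hm
  have hvi : ∀ i, -1 ≤ v i ∧ v i ≤ 1 := fun i => abs_le.1 (hv ▸ norm_le_pi_norm v i)
  have hlt : ∀ i, ⌊(v i + 1) * m⌋₊ < 2 * m + 1 := fun i =>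
    Nat.lt_succ_of_le (Nat.floor_le_of_le (by push_cast; nlinarith [hvi i]))
  refine ⟨fun i => ⟨⌊(v i + 1) * m⌋₊, hlt i⟩, ?_, fun i => ?_⟩
  · refine le_antisymm ((pi_norm_le_iff_of_nonneg zero_le_one).2 fun i => ?_) ?_
    · rw [Real.norm_eq_abs, abs_le]
      have h1 : ((⌊(v i + 1) * m⌋₊ : ℕ) : ℝ) / m ≤ 2 := by
        rw [div_le_iff₀ hm']; exact_mod_cast Nat.lt_succ_iff.1 (hlt i)
      have h2 : 0 ≤ ((⌊(v i + 1) * m⌋₊ : ℕ) : ℝ) / m := by positivity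
      constructor <;> simp only <;> linarith
    · obtain ⟨i, hi⟩ := exists_abs_apply_eq_one hv
      refine le_trans ?_ (norm_le_pi_norm _ i)
      rw [Real.norm_eq_abs]
      rcases (abs_eq zero_le_one).1 hi with h1 | h1
      · have : ((⌊(v i + 1) * m⌋₊ : ℕ) : ℝ) = 2 * m := by
          rw [h1, show ((1 : ℝ) + 1) * m = ((2 * m : ℕ) : ℝ) by push_cast; ring, Nat.floor_natCast]
          push_cast; ring
        simp only [this]
        rw [mul_div_assoc, div_self hm'.ne']
        norm_num
      · simp [h1]
  · have h0 : 0 ≤ v i + 1 := by linarith [hvi i]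
    have h1 := Nat.floor_le (mul_nonneg h0 hm'.le)
    have h2 := Nat.lt_floor_add_one ((v i + 1) * m)
    simp only
    have h3 : v i - (((⌊(v i + 1) * m⌋₊ : ℕ) : ℝ) / m - 1) =
        ((v i + 1) * m - ((⌊(v i + 1) * m⌋₊ : ℕ) : ℝ)) / m := by field_simp; ring
    rw [h3, abs_of_nonneg (div_nonneg (by linarith) hm'.le)]
    apply div_le_div_of_nonneg_right _ hm'.le
    linarith

theorem sum_measureReal_le_of_disjoint {α ι : Type*} [MeasurableSpace α] {μ : Measure α}
    [Fintype ι] {S : ι → Set α} {U : Set α} (hU : μ U ≠ ∞) (hm : ∀ i, MeasurableSet (S i))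
    (hd : Pairwise fun i j => Disjoint (S i) (S j)) (hSU : ∀ i, S i ⊆ U) :
    ∑ i, μ.real (S i) ≤ μ.real U := by
  have hf : ∀ i, μ (S i) ≠ ∞ := fun i => ne_top_of_le_ne_top hU (measure_mono (hSU i))
  rw [← measureReal_biUnion_finset (fun i _ j _ hij => hd hij) (fun i _ => hm i) (fun i _ => hf i)]
  exact measureReal_mono (iUnion₂_subset fun i _ => hSU i) hU

/-- One step of the construction: every cube of side `s` is divided into `L ^ d` blocks, and inside
each block one well-centred subcube is selected, in such a way that no line meets the new set in
much more than its expected share. -/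
theorem exists_refinement {d : ℕ} {C : Finset (Fin d → ℝ)} {s u H κ δ t : ℝ}
    {L M m : ℕ} (hM : 0 < M) (hm0 : 0 < m) (hu : 0 < u)
    (hs : s = L * ((M + 4 : ℕ) * u)) (hδ : 0 < δ) (hδ1 : δ < 1)
    (hκ : 0 < κ) (hκ1 : κ ≤ 1) (hH0 : 0 ≤ H)
    (hC01 : cubeUnion C s ⊆ Icc 0 1)
    (hdisj : ∀ c ∈ C, ∀ c' ∈ C, ∀ x ∈ closedCube c s, x ∈ closedCube c' s → c = c')
    (hline : ∀ a v : Fin d → ℝ, ‖v‖ = 1 →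
      volume (lineTrace a v (cubeUnion C s)) ≤ ENNReal.ofReal H)
    (hm : 4 / (δ * u) ≤ m)
    (hnet : (((m + 1) * (2 * m + 1) : ℕ) : ℝ) ^ d * Real.exp (-(κ * t / u)) < 1) :
    ∃ C' : Finset (Fin d → ℝ), C'.card = C.card * L ^ d ∧
      cubeUnion C' ((1 - δ) * u) ⊆ cubeUnion C s ∧
      (∀ c ∈ C', ∀ c' ∈ C', ∀ x ∈ closedCube c ((1 - δ) * u),
        x ∈ closedCube c' ((1 - δ) * u) → c = c') ∧
      (∀ a v : Fin d → ℝ, ‖v‖ = 1 → volume (lineTrace a v (cubeUnion C' ((1 - δ) * u))) ≤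
        ENNReal.ofReal ((1 + κ) * H / M ^ d + t)) ∧
      ∀ x ∈ cubeUnion C' ((1 - δ) * u), ∀ y ∈ cubeUnion C' ((1 - δ) * u),
        ‖y - x‖ ≤ 2 * u → ‖y - x‖ ≤ u := by
  classical
  have : Nonempty (Fin M) := ⟨⟨0, hM⟩⟩
  set K : ℝ := ((M + 4 : ℕ) : ℝ) with hK
  have hKM : K = M + 4 := by rw [hK]; push_cast; ring
  have hKu : 0 < K * u := by rw [hKM]; positivity
  have hδu : 0 < δ * u := by positivity
  let blk : (C × (Fin d → Fin L)) → (Fin d → ℝ) :=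
    fun β i => β.1.1 i + ((β.2 i : ℕ) : ℝ) * (K * u)
  let q : (C × (Fin d → Fin L)) → (Fin d → Fin M) → (Fin d → ℝ) :=
    fun β p i => blk β i + (((p i : ℕ) + 2 : ℕ) : ℝ) * u
  have hblk_sub : ∀ β, halfCube (blk β) (K * u) ⊆ halfCube β.1.1 s := by
    intro β x hx i
    have h1 : (((β.2 i : ℕ) : ℝ)) + 1 ≤ L := by exact_mod_cast (β.2 i).2
    have h2 := hx i
    simp only [blk] at h2
    have h3 : 0 ≤ ((β.2 i : ℕ) : ℝ) * (K * u) := by positivity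
    constructor
    · linarith
    · nlinarith
  have hwide : ∀ β p, ∀ x ∈ halfCube (q β p) u, ∀ y, ‖y - x‖ ≤ 2 * u →
      y ∈ halfCube (blk β) (K * u) := by
    intro β p x hx y hy i
    have h1 : (((p i : ℕ) : ℝ)) + 1 ≤ M := by exact_mod_cast (p i).2
    have h2 := hx i
    simp only [q] at h2
    push_cast at h2
    have h3 := abs_le.1 ((norm_le_pi_norm (y - x) i).trans hy)
    simp only [Pi.sub_apply] at h3
    have h4 : 0 ≤ (((p i : ℕ) : ℝ)) * u := by positivity
    have h5 : ((((p i : ℕ) : ℝ)) + 1) * u ≤ M * u := by gcongr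
    rw [hKM]
    constructor <;> nlinarith
  have hq_sub : ∀ β p, halfCube (q β p) u ⊆ halfCube (blk β) (K * u) := by
    intro β p x hx
    exact hwide β p x hx x (by simpa using hu.le)
  have hmemE : ∀ β p, halfCube (q β p) u ⊆ cubeUnion C s := by
    intro β p x hx
    exact mem_cubeUnion.2 ⟨β.1.1, β.1.2,
      halfCube_subset_closedCube _ _ (hblk_sub β (hq_sub β p hx))⟩
  have hblk_inj : ∀ β β' x, x ∈ halfCube (blk β) (K * u) → x ∈ halfCube (blk β') (K * u) →
      β = β' := by
    rintro ⟨c, b⟩ ⟨c', b'⟩ x hx hx'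
    have h1 : c = c' := Subtype.ext (hdisj _ c.2 _ c'.2 x
      (halfCube_subset_closedCube _ _ (hblk_sub _ hx))
      (halfCube_subset_closedCube _ _ (hblk_sub _ hx')))
    subst h1
    have h2 := eq_of_mem_halfCube_grid (c := c.1) (x := x) hKu (b := fun i => (b i : ℕ))
      (b' := fun i => (b' i : ℕ)) hx hx'
    rw [Prod.mk.injEq]
    exact ⟨rfl, funext fun i => Fin.ext (congrFun h2 i)⟩
  have hq_inj : ∀ β p p' x, x ∈ halfCube (q β p) u → x ∈ halfCube (q β p') u → p = p' := by
    intro β p p' x hx hx'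
    have h2 := eq_of_mem_halfCube_grid (c := blk β) (x := x) hu (b := fun i => (p i : ℕ) + 2)
      (b' := fun i => (p' i : ℕ) + 2) hx hx'
    exact funext fun i => Fin.ext (by have := congrFun h2 i; simpa using this)
  -- the net of lines
  let dir : (Fin d → Fin (2 * m + 1)) → (Fin d → ℝ) := fun k i => (k i : ℝ) / m - 1
  let base : (Fin d → Fin (m + 1)) → (Fin d → ℝ) := fun k i => (k i : ℝ) / m
  let J := {j : (Fin d → Fin (m + 1)) × (Fin d → Fin (2 * m + 1)) // ‖dir j.2‖ = 1}
  have hJcard : (Fintype.card J : ℝ) ≤ (((m + 1) * (2 * m + 1) : ℕ) : ℝ) ^ d := by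
    have h1 : Fintype.card J ≤ ((m + 1) * (2 * m + 1)) ^ d := by
      refine (Fintype.card_subtype_le _).trans ?_
      rw [Fintype.card_prod, Fintype.card_fun, Fintype.card_fun, Fintype.card_fin,
        Fintype.card_fin, Fintype.card_fin, mul_pow]
    exact_mod_cast h1
  let w : J → (C × (Fin d → Fin L)) → (Fin d → Fin M) → ℝ := fun j β p =>
    volume.real (lineTrace (base j.1.1) (dir j.1.2) (halfCube (q β p) u))
  have hvol : ∀ (j : J) β p,
      volume (lineTrace (base j.1.1) (dir j.1.2) (halfCube (q β p) u)) ≤ ENNReal.ofReal u := by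
    intro j β p
    refine (measure_mono fun x hx => ?_).trans (volume_lineTrace_closedCube_le (base j.1.1) (q β p) j.2 u)
    exact halfCube_subset_closedCube _ _ hx
  obtain ⟨ω, hω⟩ := exists_choice_forall_sum_le w (u := u) (H := H) (κ := κ) (t := t) hu hκ hκ1
    (fun j β p => measureReal_nonneg)
    (fun j β p => ENNReal.toReal_le_of_le_ofReal hu.le (hvol j β p))
    (fun j => by
      rw [← Fintype.sum_prod_type']
      have hfin : volume (lineTrace (base j.1.1) (dir j.1.2) (cubeUnion C s)) ≠ ∞ :=
        ne_top_of_le_ne_top ENNReal.ofReal_ne_top (hline _ _ j.2)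
      refine (sum_measureReal_le_of_disjoint hfin
        (fun i => measurableSet_lineTrace _ _ (measurableSet_halfCube _ _)) ?_ ?_).trans
        (ENNReal.toReal_le_of_le_ofReal hH0 (hline _ _ j.2))
      · rintro ⟨β, p⟩ ⟨β', p'⟩ hne
        refine Set.disjoint_left.2 fun x hx hx' => hne ?_
        have h1 := hblk_inj β β' _ (hq_sub _ _ hx) (hq_sub _ _ hx')
        subst h1
        rw [hq_inj β p p' _ hx hx']
      · rintro ⟨β, p⟩ x hx
        exact hmemE β p hx)
    (lt_of_le_of_lt (by gcongr) hnet)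
  -- the new cubes
  let cor : (C × (Fin d → Fin L)) → (Fin d → ℝ) := fun β i => q β (ω β) i + δ * u / 2
  have hs' : 0 ≤ (1 - δ) * u := mul_nonneg (by linarith) hu.le
  have hcor_near : ∀ β, ∀ x ∈ closedCube (cor β) ((1 - δ) * u), ∀ y : Fin d → ℝ,
      (∀ i, |x i - y i| < δ * u / 2) → y ∈ halfCube (q β (ω β)) u := by
    intro β x hx y hy i
    have h1 := hx i
    have h2 := abs_lt.1 (hy i)
    simp only [cor] at h1
    constructor
    · linarith
    · nlinarith
  have hcor_sub : ∀ β, closedCube (cor β) ((1 - δ) * u) ⊆ halfCube (q β (ω β)) u :=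
    fun β x hx => hcor_near β x hx x fun i => by rw [sub_self, abs_zero]; positivity
  have hcor_self : ∀ β, cor β ∈ closedCube (cor β) ((1 - δ) * u) := fun β i =>
    ⟨le_rfl, by linarith⟩
  have hcor_inj : Function.Injective cor := by
    intro β β' h
    refine hblk_inj β β' (cor β) (hq_sub _ _ (hcor_sub _ (hcor_self β))) ?_
    rw [h]
    exact hq_sub _ _ (hcor_sub _ (hcor_self β'))
  have hmem : ∀ x, x ∈ cubeUnion (Finset.univ.image cor) ((1 - δ) * u) ↔
      ∃ β, x ∈ closedCube (cor β) ((1 - δ) * u) := by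
    intro x
    simp [mem_cubeUnion]
  have hsub : cubeUnion (Finset.univ.image cor) ((1 - δ) * u) ⊆ cubeUnion C s := by
    intro x hx
    obtain ⟨β, hβ⟩ := (hmem x).1 hx
    exact hmemE β _ (hcor_sub β hβ)
  refine ⟨Finset.univ.image cor, ?_, hsub, ?_, ?_, ?_⟩
  · rw [Finset.card_image_of_injective _ hcor_inj, Finset.card_univ, Fintype.card_prod,
      Fintype.card_coe, Fintype.card_fun, Fintype.card_fin, Fintype.card_fin]
  · intro c hc c' hc' x hx hx'
    obtain ⟨β, -, rfl⟩ := Finset.mem_image.1 hc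
    obtain ⟨β', -, rfl⟩ := Finset.mem_image.1 hc'
    rw [hblk_inj β β' x (hq_sub _ _ (hcor_sub _ hx)) (hq_sub _ _ (hcor_sub _ hx'))]
  · intro a v hv
    rcases (lineTrace a v (cubeUnion (Finset.univ.image cor) ((1 - δ) * u))).eq_empty_or_nonempty
      with hemp | ⟨t₀, ht₀⟩
    · rw [hemp, measure_empty]; exact zero_le
    rw [← volume_lineTrace_add_smul a v t₀]
    set x₀ := a + t₀ • v with hx₀
    have hx₀01 : x₀ ∈ Icc (0 : Fin d → ℝ) 1 := hC01 (hsub ht₀)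
    obtain ⟨k, hk⟩ := exists_grid_point_near hm0 hx₀01
    obtain ⟨l, hl1, hl⟩ := exists_grid_direction_near hm0 hv
    have hm0' : (0 : ℝ) < m := by exact_mod_cast hm0
    have hmδ : 2 * (1 / (m : ℝ)) ≤ δ * u / 2 := by
      rw [div_le_iff₀ hδu] at hm
      rw [mul_one_div, div_le_iff₀ hm0']
      linarith
    let j : J := ⟨(k, l), hl1⟩
    have hcov : lineTrace x₀ v (cubeUnion (Finset.univ.image cor) ((1 - δ) * u)) ⊆
        ⋃ β ∈ (Finset.univ : Finset (C × (Fin d → Fin L))),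
          lineTrace (base k) (dir l) (halfCube (q β (ω β)) u) := by
      intro τ hτ
      have hx01 : x₀ + τ • v ∈ Icc (0 : Fin d → ℝ) 1 := hC01 (hsub hτ)
      obtain ⟨β, hβ⟩ := (hmem _).1 hτ
      refine mem_iUnion₂.2 ⟨β, Finset.mem_univ _, ?_⟩
      have hτ1 : |τ| ≤ 1 := by
        obtain ⟨i, hi⟩ := exists_abs_apply_eq_one hv
        have h1 := hx01.1 i; have h2 := hx01.2 i
        have h3 := hx₀01.1 i; have h4 := hx₀01.2 i
        simp only [Pi.add_apply, Pi.smul_apply, smul_eq_mul, Pi.zero_apply, Pi.one_apply]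
          at h1 h2 h3 h4
        have : |τ * v i| ≤ 1 := by rw [abs_le]; constructor <;> linarith
        rwa [abs_mul, hi, mul_one] at this
      refine hcor_near β _ hβ _ fun i => ?_
      simp only [Pi.add_apply, Pi.smul_apply, smul_eq_mul]
      have h5 : x₀ i + τ * v i - (base k i + τ * dir l i) =
          (x₀ i - base k i) + τ * (v i - dir l i) := by ring
      rw [h5]
      have h6 : |τ * (v i - dir l i)| ≤ 1 * (1 / m) := by
        rw [abs_mul]
        exact mul_le_mul hτ1 (hl i) (abs_nonneg _) zero_le_one
      have h7 : |x₀ i - base k i| < 1 / m := hk i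
      calc _ ≤ |x₀ i - base k i| + |τ * (v i - dir l i)| := abs_add_le _ _
        _ < δ * u / 2 := by linarith
    refine (measure_mono hcov).trans ((measure_biUnion_finset_le _ _).trans ?_)
    have hreal : ∀ β, volume (lineTrace (base k) (dir l) (halfCube (q β (ω β)) u)) =
        ENNReal.ofReal (w j β (ω β)) := fun β =>
      (ENNReal.ofReal_toReal (ne_top_of_le_ne_top ENNReal.ofReal_ne_top (hvol j β _))).symm
    simp only [hreal]
    rw [← ENNReal.ofReal_sum_of_nonneg fun β _ => measureReal_nonneg]
    apply ENNReal.ofReal_le_ofReal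
    have := hω j
    rwa [Fintype.card_fun, Fintype.card_fin, Fintype.card_fin, Nat.cast_pow] at this
  · intro x hx y hy hxy
    obtain ⟨β, hβ⟩ := (hmem x).1 hx
    obtain ⟨β', hβmem⟩ := (hmem y).1 hy
    have h1 := hblk_inj β β' y (hwide β _ x (hcor_sub _ hβ) y hxy) (hq_sub _ _ (hcor_sub _ hβmem))
    subst h1
    exact norm_sub_le_of_mem_closedCube hu.le (halfCube_subset_closedCube _ _ (hcor_sub _ hβ))
      (halfCube_subset_closedCube _ _ (hcor_sub _ hβmem))

/-- The open sup-norm neighbourhood of radius `w` of the line `t ↦ a + t v`. -/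
def openTube {d : ℕ} (a v : Fin d → ℝ) (w : ℝ) : Set (Fin d → ℝ) :=
  {x | ∃ t : ℝ, ‖x - (a + t • v)‖ < w}

theorem isOpen_openTube {d : ℕ} (a v : Fin d → ℝ) (w : ℝ) : IsOpen (openTube a v w) := by
  have : openTube a v w = ⋃ t : ℝ, ball (a + t • v) w := by
    ext x
    simp [openTube, dist_eq_norm]
  rw [this]
  exact isOpen_iUnion fun t => isOpen_ball

theorem volume_openTube_inter_box_le {d : ℕ} (a : Fin d → ℝ) {v : Fin d → ℝ} (hv : ‖v‖ = 1)
    {w : ℝ} (hw : 0 < w) (hw2 : w ≤ 2) :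
    volume (openTube a v w ∩ Icc (-1) 2) ≤
      ENNReal.ofReal (9 * 4 ^ d) * ENNReal.ofReal w ^ (d - 1) := by
  obtain ⟨i, hi⟩ := exists_abs_apply_eq_one hv
  have hd : d - 1 + 1 = d := by have := i.2; omega
  have hsq : v i * v i = 1 := by rw [← abs_mul_abs_self, hi, one_mul]
  set τ₀ := -1 - a i - w with hτ₀
  let z : ℕ → Fin d → ℝ := fun k => a + ((τ₀ + k * w) * v i) • v
  have hcov : openTube a v w ∩ Icc (-1) 2 ⊆
      ⋃ k ∈ Finset.range (⌊7 / w⌋₊ + 1), closedBall (z k) (2 * w) := by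
    rintro x ⟨⟨t, ht⟩, hx⟩
    have h1 : |x i - (a i + t * v i)| < w := (norm_le_pi_norm (x - (a + t • v)) i).trans_lt ht
    have h2 : -1 ≤ x i := hx.1 i
    have h3 : x i ≤ 2 := hx.2 i
    rw [abs_lt] at h1
    have h0 : 0 ≤ (t * v i - τ₀) / w := div_nonneg (by linarith) hw.le
    refine mem_iUnion₂.2 ⟨⌊(t * v i - τ₀) / w⌋₊, ?_, ?_⟩
    · rw [Finset.mem_range, Nat.lt_succ_iff]
      apply Nat.floor_mono
      apply div_le_div_of_nonneg_right _ hw.le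
      linarith
    · have h4 := Nat.floor_le h0
      have h5 := Nat.lt_floor_add_one ((t * v i - τ₀) / w)
      set k := ⌊(t * v i - τ₀) / w⌋₊
      rw [le_div_iff₀ hw] at h4
      rw [div_lt_iff₀ hw] at h5
      rw [mem_closedBall, dist_eq_norm]
      have h6 : x - z k = (x - (a + t • v)) + ((t * v i - (τ₀ + k * w)) * v i) • v := by
        have : t = t * v i * v i := by rw [mul_assoc, hsq, mul_one]
        funext l
        simp only [z, Pi.sub_apply, Pi.add_apply, Pi.smul_apply, smul_eq_mul]
        linear_combination (v l) * this
      rw [h6]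
      refine (norm_add_le _ _).trans ?_
      rw [norm_smul, hv, mul_one, Real.norm_eq_abs, abs_mul, hi, mul_one,
        abs_of_nonneg (by linarith)]
      linarith
  refine (measure_mono hcov).trans ((measure_biUnion_finset_le _ _).trans ?_)
  simp only [Real.volume_pi_closedBall _ (by positivity : 0 ≤ 2 * w), Finset.sum_const,
    Finset.card_range, nsmul_eq_mul, Fintype.card_fin]
  rw [← ENNReal.ofReal_natCast, ← ENNReal.ofReal_pow hw.le, ← ENNReal.ofReal_mul (by positivity),
    ← ENNReal.ofReal_mul (by positivity)]
  apply ENNReal.ofReal_le_ofReal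
  have h7 : ((⌊7 / w⌋₊ + 1 : ℕ) : ℝ) * w ≤ 9 := by
    have := Nat.floor_le (show 0 ≤ 7 / w by positivity)
    rw [le_div_iff₀ hw] at this
    push_cast
    linarith
  have h8 : w ^ d = w * w ^ (d - 1) := by rw [← pow_succ', hd]
  calc ((⌊7 / w⌋₊ + 1 : ℕ) : ℝ) * (2 * (2 * w)) ^ d
      = (((⌊7 / w⌋₊ + 1 : ℕ) : ℝ) * w) * (4 ^ d * w ^ (d - 1)) := by
        rw [show 2 * (2 * w) = 4 * w by ring, mul_pow, h8]; ring
    _ ≤ 9 * (4 ^ d * w ^ (d - 1)) := by gcongr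
    _ = _ := by ring

/-- A bound for the lengths of line sections gives a bound for the volume in tubes. -/
theorem volume_inter_openTube_le {d : ℕ} {E : Set (Fin d → ℝ)} (hE : MeasurableSet E)
    (hE01 : E ⊆ Icc 0 1) {H : ℝ≥0∞} (a : Fin d → ℝ) {v : Fin d → ℝ} (hv : ‖v‖ = 1)
    (hline : ∀ b, volume (lineTrace b v E) ≤ H) {w : ℝ} (hw : 0 < w) (hw2 : w ≤ 2) :
    volume (E ∩ openTube a v w) ≤
      H * (ENNReal.ofReal (9 * 4 ^ d) * ENNReal.ofReal w ^ (d - 1)) := by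
  set S := E ∩ openTube a v w with hS
  have hSm : MeasurableSet S := hE.inter (isOpen_openTube a v w).measurableSet
  set Q := openTube a v w ∩ Icc (-1) 2 with hQ
  have hQm : MeasurableSet Q := (isOpen_openTube a v w).measurableSet.inter measurableSet_Icc
  have h1 : ∀ t : ℝ, ∫⁻ x : Fin d → ℝ, S.indicator 1 (x + t • v) = volume S := by
    intro t
    rw [lintegral_add_right_eq_self (fun x => S.indicator 1 x) (t • v), lintegral_indicator_one hSm]
  have h2 : ∀ x, ∫⁻ t in Icc (0 : ℝ) 1, S.indicator 1 (x + t • v) ≤ Q.indicator (fun _ => H) x := by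
    intro x
    have hind : ∀ t, S.indicator (1 : (Fin d → ℝ) → ℝ≥0∞) (x + t • v) =
        (lineTrace x v S).indicator 1 t := fun t => by
      rfl
    simp only [hind]
    rw [lintegral_indicator_one (measurableSet_lineTrace _ _ hSm)]
    by_cases hx : x ∈ Q
    · rw [Set.indicator_of_mem hx]
      refine (Measure.restrict_apply_le _ _).trans ((measure_mono fun t ht => ?_).trans (hline x))
      exact ht.1
    · rw [Set.indicator_of_notMem hx, nonpos_iff_eq_zero,
        Measure.restrict_apply (measurableSet_lineTrace _ _ hSm)]
      convert measure_empty (μ := volume)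
      rw [Set.eq_empty_iff_forall_notMem]
      rintro t ⟨⟨htE, τ, hτ⟩, ht0, ht1⟩
      refine hx ⟨⟨τ - t, ?_⟩, ?_, ?_⟩
      · convert hτ using 2
        rw [sub_smul]; abel
      · intro i
        have := (hE01 htE).1 i
        have h3 := abs_le.1 (hv ▸ norm_le_pi_norm v i : |v i| ≤ 1)
        simp only [Pi.add_apply, Pi.smul_apply, smul_eq_mul, Pi.zero_apply] at this
        simp only [Pi.neg_apply, Pi.one_apply]
        nlinarith
      · intro i
        have := (hE01 htE).2 i
        have h3 := abs_le.1 (hv ▸ norm_le_pi_norm v i : |v i| ≤ 1)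
        have h4 := (hE01 htE).1 i
        simp only [Pi.add_apply, Pi.smul_apply, smul_eq_mul, Pi.zero_apply, Pi.one_apply] at this h4
        simp only [Pi.ofNat_apply]
        nlinarith
  have hmeas : Measurable fun p : ℝ × (Fin d → ℝ) =>
      S.indicator (1 : (Fin d → ℝ) → ℝ≥0∞) (p.2 + p.1 • v) :=
    (measurable_one.indicator hSm).comp (by fun_prop)
  calc volume S = ∫⁻ t in Icc (0 : ℝ) 1, ∫⁻ x : Fin d → ℝ, S.indicator 1 (x + t • v) := by
        simp [h1]
    _ = ∫⁻ x : Fin d → ℝ, ∫⁻ t in Icc (0 : ℝ) 1, S.indicator 1 (x + t • v) :=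
        lintegral_lintegral_swap hmeas.aemeasurable
    _ ≤ ∫⁻ x : Fin d → ℝ, Q.indicator (fun _ => H) x := lintegral_mono h2
    _ = H * volume Q := lintegral_indicator_const hQm H
    _ ≤ _ := by gcongr; exact volume_openTube_inter_box_le a hv hw hw2

/-- A decreasing intersection of compact sets whose line sections are all comparable to their
volume is not tube null. -/
theorem not_tubeNull_of_volume_lineTrace_le {d : ℕ} {E : ℕ → Set (Fin d → ℝ)}
    (hcomp : ∀ n, IsCompact (E n)) (hanti : Antitone E) (h01 : E 0 ⊆ Icc 0 1) {V : ℕ → ℝ≥0∞}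
    (hV0 : ∀ n, V n ≠ 0) (hVtop : ∀ n, V n ≠ ∞) (hvol : ∀ n, V n ≤ volume (E n))
    (hline : ∀ n, ∀ a v : Fin d → ℝ, ‖v‖ = 1 → volume (lineTrace a v (E n)) ≤ 2 * V n) :
    ¬ TubeNull d (WithLp.ofLp ⁻¹' ⋂ n, E n) := by
  intro hnull
  set c : ℝ := 2 * (9 * 4 ^ d) * 2 ^ (d - 1) with hc
  have hc0 : 0 < c := by positivity
  have hc1 : 1 ≤ c := by
    have h1 : (1 : ℝ) ≤ 4 ^ d := one_le_pow₀ (by norm_num)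
    have h2 : (1 : ℝ) ≤ 2 ^ (d - 1) := one_le_pow₀ (by norm_num)
    nlinarith
  obtain ⟨T, w, hTw, hcov, hsum⟩ := hnull (1 / (2 * c)) (by positivity)
  have hw1 : ∀ n, w n ≤ 1 := by
    intro n
    by_contra! h
    have h1 : (1 : ℝ≥0∞) ≤ ENNReal.ofReal (w n) ^ (d - 1) := by
      apply one_le_pow₀
      rw [← ENNReal.ofReal_one]
      exact ENNReal.ofReal_le_ofReal h.le
    have h2 := (h1.trans (ENNReal.le_tsum n)).trans hsum
    rw [← ENNReal.ofReal_one, ENNReal.ofReal_le_ofReal_iff (by positivity),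
      le_div_iff₀ (by positivity)] at h2
    linarith
  have htube : ∀ n, ∃ a v : Fin d → ℝ, ‖v‖ = 1 ∧
      ∀ x ∈ T n, WithLp.ofLp x ∈ openTube a v (2 * w n) := by
    intro n
    obtain ⟨hw, L, ⟨a, v, hv, rfl⟩, hT⟩ := hTw n
    have hv' : WithLp.ofLp v ≠ 0 := fun h => hv (by ext i; exact congrFun h i)
    have hn : 0 < ‖WithLp.ofLp v‖ := norm_pos_iff.2 hv'
    refine ⟨WithLp.ofLp a, ‖WithLp.ofLp v‖⁻¹ • WithLp.ofLp v, ?_, fun x hx => ?_⟩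
    · rw [norm_smul, norm_inv, norm_norm, inv_mul_cancel₀ hn.ne']
    · rw [hT] at hx
      obtain ⟨y, ⟨t, rfl⟩, hy⟩ := mem_thickening_iff.1
        (cthickening_subset_thickening' (by linarith) (by linarith : w n < 2 * w n) _ hx)
      refine ⟨t * ‖WithLp.ofLp v‖, ?_⟩
      rw [smul_smul, mul_assoc, mul_inv_cancel₀ hn.ne', mul_one]
      refine lt_of_le_of_lt ?_ hy
      rw [dist_eq_norm]
      refine (pi_norm_le_iff_of_nonneg (norm_nonneg _)).2 fun i => ?_
      exact PiLp.norm_apply_le (x - (a + t • v)) i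
  choose a v hv hmem using htube
  have hcov' : ⋂ n, E n ⊆ ⋃ n, openTube (a n) (v n) (2 * w n) := by
    intro x hx
    obtain ⟨n, hn⟩ := mem_iUnion.1 (hcov (show WithLp.toLp 2 x ∈ WithLp.ofLp ⁻¹' ⋂ n, E n from hx))
    exact mem_iUnion.2 ⟨n, hmem n _ hn⟩
  have hcompI : IsCompact (⋂ n, E n) :=
    (hcomp 0).of_isClosed_subset (isClosed_iInter fun n => (hcomp n).isClosed) (iInter_subset _ 0)
  obtain ⟨J, hJ⟩ := hcompI.elim_finite_subcover _ (fun n => isOpen_openTube _ _ _) hcov'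
  have hopen : IsOpen (⋃ n ∈ J, openTube (a n) (v n) (2 * w n)) :=
    isOpen_biUnion fun n _ => isOpen_openTube _ _ _
  obtain ⟨k, hk⟩ := exists_subset_nhds_of_isCompact hanti.directed_ge hcomp
    (fun x hx => hopen.mem_nhds (hJ hx))
  have hfin : volume (E k) ≤ ∑ n ∈ J, volume (E k ∩ openTube (a n) (v n) (2 * w n)) := by
    refine (measure_mono fun x hx => ?_).trans (measure_biUnion_finset_le _ _)
    obtain ⟨n, hn, hx'⟩ := mem_iUnion₂.1 (hk hx)
    exact mem_iUnion₂.2 ⟨n, hn, hx, hx'⟩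
  have hlt : V k < V k := by
    calc V k ≤ ∑ n ∈ J, volume (E k ∩ openTube (a n) (v n) (2 * w n)) := (hvol k).trans hfin
      _ ≤ ∑ n ∈ J, 2 * V k * (ENNReal.ofReal (9 * 4 ^ d) * ENNReal.ofReal (2 * w n) ^ (d - 1)) := by
          refine Finset.sum_le_sum fun n _ => ?_
          exact volume_inter_openTube_le (hcomp k).isClosed.measurableSet
            ((hanti (Nat.zero_le k)).trans h01) (a n) (hv n) (fun b => hline k b _ (hv n))
            (by linarith [(hTw n).1]) (by linarith [hw1 n])
      _ = V k * (ENNReal.ofReal c * ∑ n ∈ J, ENNReal.ofReal (w n) ^ (d - 1)) := by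
          rw [Finset.mul_sum, Finset.mul_sum]
          refine Finset.sum_congr rfl fun n _ => ?_
          have h2 : ENNReal.ofReal 2 = 2 := ENNReal.ofReal_ofNat 2
          have hcE : ENNReal.ofReal c = 2 * ENNReal.ofReal (9 * 4 ^ d) * 2 ^ (d - 1) := by
            rw [hc, ENNReal.ofReal_mul (by positivity),
              ENNReal.ofReal_mul (by norm_num : (0 : ℝ) ≤ 2),
              ENNReal.ofReal_pow (by norm_num : (0 : ℝ) ≤ 2), h2]
          have hwE : ENNReal.ofReal (2 * w n) = 2 * ENNReal.ofReal (w n) := by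
            rw [ENNReal.ofReal_mul (by norm_num : (0 : ℝ) ≤ 2), h2]
          rw [hcE, hwE, mul_pow]
          ring
      _ ≤ V k * (ENNReal.ofReal c * ENNReal.ofReal (1 / (2 * c))) := by
          gcongr
          exact (ENNReal.sum_le_tsum J).trans hsum
      _ = V k * ENNReal.ofReal (1 / 2) := by
          rw [← ENNReal.ofReal_mul hc0.le]
          congr 2
          field_simp
      _ < V k * 1 := by
          refine ENNReal.mul_lt_mul_right (hV0 k) (hVtop k) ?_
          rw [← ENNReal.ofReal_one]
          exact (ENNReal.ofReal_lt_ofReal_iff one_pos).2 (by norm_num)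
      _ = V k := mul_one _
  exact hlt.false

/-- A set of Hausdorff dimension less than `d - 1` is tube null. -/
theorem tubeNull_of_dimH_lt {d : ℕ} (hd : 2 ≤ d) {A : Set (Pt d)}
    (hA : dimH A < ((d - 1 : ℕ) : ℝ≥0∞)) : TubeNull d A := by
  intro δ hδ
  have hd1 : d - 1 ≠ 0 := by omega
  have hμ : μH[((d - 1 : ℕ) : ℝ)] A = 0 := by
    have := hausdorffMeasure_of_dimH_lt (s := A) (d := ((d - 1 : ℕ) : ℝ≥0)) (by exact_mod_cast hA)
    rwa [NNReal.coe_natCast] at this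
  rw [Measure.hausdorffMeasure_apply, ENNReal.iSup_eq_zero] at hμ
  have h1 := hμ 1
  rw [ENNReal.iSup_eq_zero] at h1
  have h2 := h1 one_pos
  have h3 : ∃ t : ℕ → Set (Pt d), A ⊆ ⋃ n, t n ∧ (∀ n, ediam (t n) ≤ 1) ∧
      ∑' n, ⨆ _ : (t n).Nonempty, ediam (t n) ^ ((d - 1 : ℕ) : ℝ) < ENNReal.ofReal (δ / 2) := by
    have h4 : (⨅ (t : ℕ → Set (Pt d)) (_ : A ⊆ ⋃ n, t n) (_ : ∀ n, ediam (t n) ≤ 1),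
        ∑' n, ⨆ _ : (t n).Nonempty, ediam (t n) ^ ((d - 1 : ℕ) : ℝ)) < ENNReal.ofReal (δ / 2) := by
      rw [h2]
      exact ENNReal.ofReal_pos.2 (by positivity)
    simp only [iInf_lt_iff] at h4
    obtain ⟨t, ht1, ht2, ht3⟩ := h4
    exact ⟨t, ht1, ht2, ht3⟩
  obtain ⟨t, hcov, hdiam, hsum⟩ := h3
  let b : ℕ → ℝ := fun n => (ediam (t n)).toReal ^ (d - 1) + δ / 2 / 2 / 2 ^ n
  have hb0 : ∀ n, 0 < b n := fun n => by positivity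
  let w : ℕ → ℝ := fun n => b n ^ (((d - 1 : ℕ) : ℝ)⁻¹)
  have hw0 : ∀ n, 0 < w n := fun n => Real.rpow_pos_of_pos (hb0 n) _
  have hwb : ∀ n, w n ^ (d - 1) = b n := fun n => Real.rpow_inv_natCast_pow (hb0 n).le hd1
  have hdw : ∀ n, (ediam (t n)).toReal ≤ w n := by
    intro n
    refine le_of_pow_le_pow_left₀ hd1 (hw0 n).le ?_
    rw [hwb]
    have : 0 < δ / 2 / 2 / 2 ^ n := by positivity
    simp only [b]
    linarith
  obtain ⟨v, hv⟩ : ∃ v : Pt d, v ≠ 0 := by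
    refine ⟨EuclideanSpace.single (⟨0, by omega⟩ : Fin d) (1 : ℝ), fun h => ?_⟩
    have := congrArg (fun x : Pt d => x ⟨0, by omega⟩) h
    simp at this
  have htube : ∀ n, ∃ T : Set (Pt d), IsTube (w n) T ∧ t n ⊆ T := by
    intro n
    rcases (t n).eq_empty_or_nonempty with h | ⟨a, ha⟩
    · exact ⟨_, ⟨_, ⟨0, v, hv, rfl⟩, rfl⟩, by simp [h]⟩
    · refine ⟨_, ⟨_, ⟨a, v, hv, rfl⟩, rfl⟩, fun x hx => ?_⟩
      refine mem_cthickening_of_edist_le x a _ _ ⟨0, by simp⟩ ?_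
      refine (edist_le_ediam_of_mem hx ha).trans ?_
      rw [← ENNReal.ofReal_toReal (ne_top_of_le_ne_top ENNReal.one_ne_top (hdiam n))]
      exact ENNReal.ofReal_le_ofReal (hdw n)
  choose T hT htT using htube
  refine ⟨T, w, fun n => ⟨hw0 n, hT n⟩, hcov.trans (iUnion_mono htT), ?_⟩
  have hterm : ∀ n, ENNReal.ofReal (w n) ^ (d - 1) ≤
      (⨆ _ : (t n).Nonempty, ediam (t n) ^ ((d - 1 : ℕ) : ℝ)) +
        ENNReal.ofReal (δ / 2 / 2 / 2 ^ n) := by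
    intro n
    rw [← ENNReal.ofReal_pow (hw0 n).le, hwb, ENNReal.ofReal_add (by positivity) (by positivity),
      ENNReal.ofReal_pow ENNReal.toReal_nonneg,
      ENNReal.ofReal_toReal (ne_top_of_le_ne_top ENNReal.one_ne_top (hdiam n))]
    gcongr
    rcases (t n).eq_empty_or_nonempty with h | h
    · simp [h, hd1]
    · simp [h]
  calc ∑' n, ENNReal.ofReal (w n) ^ (d - 1)
      ≤ ∑' n, ((⨆ _ : (t n).Nonempty, ediam (t n) ^ ((d - 1 : ℕ) : ℝ)) +
        ENNReal.ofReal (δ / 2 / 2 / 2 ^ n)) := ENNReal.tsum_le_tsum hterm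
    _ ≤ ENNReal.ofReal (δ / 2) + ENNReal.ofReal (δ / 2) := by
        rw [ENNReal.tsum_add]
        gcongr
        rw [← ENNReal.ofReal_tsum_of_nonneg (fun n => by positivity) (summable_geometric_two' _),
          tsum_geometric_two']
    _ = ENNReal.ofReal δ := by
        rw [← ENNReal.ofReal_add (by positivity) (by positivity), add_halves]

/-- A set covered by at most `r ^ (-(D + ε))` balls of every small radius `r` has Hausdorff
dimension at most `D`. -/
theorem dimH_le_of_forall_exists_card_le {X : Type*} [MetricSpace X] {A : Set X} {D : ℝ}
    (hD : 0 ≤ D)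
    (hA : ∀ ε : ℝ, 0 < ε → ∃ r₀ : ℝ, 0 < r₀ ∧ ∀ r : ℝ, 0 < r → r < r₀ →
      ∃ F : Finset X, (A ⊆ ⋃ x ∈ F, closedBall x r) ∧ (F.card : ℝ) ≤ r ^ (-(D + ε))) :
    dimH A ≤ ENNReal.ofReal D := by
  borelize X
  refine ENNReal.le_of_forall_pos_le_add fun ε hε _ => ?_
  have hε' : (0 : ℝ) < ε := hε
  obtain ⟨r₀, hr₀, hr⟩ := hA ε hε'
  have hseq : ∀ n : ℕ, 0 < r₀ / (n + 2) ∧ r₀ / (n + 2) < r₀ := fun n =>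
    ⟨by positivity, div_lt_self hr₀ (by have : (0 : ℝ) ≤ n := n.cast_nonneg; linarith)⟩
  choose F hF hcard using fun n : ℕ => hr (r₀ / (n + 2)) (hseq n).1 (hseq n).2
  have hdE : ENNReal.ofReal D + ε = ((D.toNNReal + ε : ℝ≥0) : ℝ≥0∞) := by
    rw [ENNReal.coe_add]; rfl
  rw [hdE]
  refine dimH_le_of_hausdorffMeasure_ne_top ?_
  have hDε : ((D.toNNReal + ε : ℝ≥0) : ℝ) = D + ε := by
    rw [NNReal.coe_add, Real.coe_toNNReal _ hD]
  rw [hDε]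
  have hlim : Filter.Tendsto (fun n : ℕ => ENNReal.ofReal (2 * (r₀ / (n + 2)))) Filter.atTop
      (nhds 0) := by
    rw [← ENNReal.ofReal_zero]
    refine ENNReal.tendsto_ofReal ?_
    have : Filter.Tendsto (fun n : ℕ => (n : ℝ) + 2) Filter.atTop Filter.atTop :=
      Filter.tendsto_atTop_add_const_right _ _ tendsto_natCast_atTop_atTop
    simpa using (this.const_div_atTop r₀).const_mul 2
  have hdi : ∀ n (i : F n), ediam (closedBall (i : X) (r₀ / (n + 2))) ≤
      ENNReal.ofReal (2 * (r₀ / (n + 2))) := by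
    intro n i
    refine ediam_le fun x hx y hy => ?_
    rw [edist_dist]
    refine ENNReal.ofReal_le_ofReal ?_
    linarith [dist_triangle_right x y i, mem_closedBall.1 hx, mem_closedBall.1 hy]
  have hle := Measure.hausdorffMeasure_le_liminf_sum (ι := fun n : ℕ => F n) (D + ε) A _ hlim
    (fun n i => closedBall (i : X) (r₀ / (n + 2))) (Filter.Eventually.of_forall hdi)
    (Filter.Eventually.of_forall fun n x hx => by
      obtain ⟨i, hi, hx⟩ := mem_iUnion₂.1 (hF n hx)
      exact mem_iUnion.2 ⟨⟨i, hi⟩, hx⟩)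
  refine ne_top_of_le_ne_top (ENNReal.ofReal_ne_top (r := 2 ^ (D + ε))) (hle.trans ?_)
  refine Filter.liminf_le_of_frequently_le' (Filter.Frequently.of_forall fun n => ?_)
  set r := r₀ / ((n : ℝ) + 2) with hrdef
  have hr0 : 0 < r := (hseq n).1
  calc ∑ i : F n, ediam (closedBall (i : X) r) ^ (D + ε)
      ≤ ∑ _i : F n, ENNReal.ofReal (2 * r) ^ (D + ε) :=
        Finset.sum_le_sum fun i _ => ENNReal.rpow_le_rpow (hdi n i) (by linarith)
    _ = ENNReal.ofReal ((F n).card * (2 * r) ^ (D + ε)) := by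
        rw [Finset.sum_const, Finset.card_univ, Fintype.card_coe, nsmul_eq_mul,
          ENNReal.ofReal_mul (Nat.cast_nonneg _), ENNReal.ofReal_natCast,
          ENNReal.ofReal_rpow_of_pos (by positivity)]
    _ ≤ ENNReal.ofReal (2 ^ (D + ε)) := by
        refine ENNReal.ofReal_le_ofReal ?_
        calc ((F n).card : ℝ) * (2 * r) ^ (D + ε) ≤ r ^ (-(D + ε)) * (2 * r) ^ (D + ε) := by
              gcongr
              exact hcard n
          _ = 2 ^ (D + ε) := by
              rw [Real.mul_rpow (by norm_num) hr0.le, Real.rpow_neg hr0.le]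
              have : r ^ (D + ε) ≠ 0 := (Real.rpow_pos_of_pos hr0 _).ne'
              field_simp

/-- The base of the construction: all scales are essentially powers of it. -/
def scaleBase (d : ℕ) : ℕ := 100 * 4 ^ d

/-- Minus the logarithm, in base `scaleBase d`, of the side length at stage `n`. -/
def sideExp (d : ℕ) : ℕ → ℕ
  | 0 => 0
  | n + 1 => sideExp d n + (5 + (n + 1) * d)

/-- The product of the shrinking factors used up to stage `n`. -/
def shrink (d : ℕ) : ℕ → ℝ
  | 0 => 1
  | n + 1 => shrink d n * (1 - ((scaleBase d : ℝ) ^ (n + 1))⁻¹)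

/-- The side length of the cubes at stage `n`. -/
def sideLen (d n : ℕ) : ℝ := shrink d n / (scaleBase d : ℝ) ^ sideExp d n

/-- The number of subdivisions of each side at stage `n`. -/
def branching (d n : ℕ) : ℕ := scaleBase d ^ (5 + (n + 1) * (d - 1))

/-- The number of cubes at stage `n`. -/
def cubeCount (d : ℕ) : ℕ → ℕ
  | 0 => 1
  | n + 1 => cubeCount d n * branching d n ^ d

/-- The number of positions in each coordinate at stage `n`. -/
def positions (d n : ℕ) : ℕ := scaleBase d ^ (n + 1) - 4

/-- The bound for the length of line sections at stage `n`. -/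
def sectionBound (d : ℕ) : ℕ → ℝ
  | 0 => 1
  | n + 1 => (1 + 2 * ((scaleBase d : ℝ) ^ (n + 1))⁻¹) * sectionBound d n / (positions d n : ℝ) ^ d

theorem two_pow_le_scaleBase (d : ℕ) : 2 ^ d ≤ scaleBase d := by
  have : 2 ^ d ≤ 4 ^ d := Nat.pow_le_pow_left (by norm_num) d
  unfold scaleBase
  omega

theorem mul_sq_le_scaleBase (d : ℕ) : 100 * d ^ 2 ≤ scaleBase d := by
  have h : d ^ 2 ≤ (2 ^ d) ^ 2 := Nat.pow_le_pow_left d.lt_two_pow_self.le 2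
  have h4 : (2 ^ d) ^ 2 = 4 ^ d := by rw [← pow_mul, mul_comm, pow_mul]; norm_num
  unfold scaleBase
  omega

theorem hundred_le_scaleBase (d : ℕ) : 100 ≤ scaleBase d := by
  have : 1 ≤ 4 ^ d := Nat.one_le_pow _ _ (by norm_num)
  unfold scaleBase
  omega

theorem hundred_le_scaleBase_real (d : ℕ) : (100 : ℝ) ≤ scaleBase d := by
  exact_mod_cast hundred_le_scaleBase d

theorem scaleBase_mul_two_pow_le (d n : ℕ) :
    (scaleBase d : ℝ) * 2 ^ n ≤ (scaleBase d : ℝ) ^ (n + 1) := by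
  rw [pow_succ']
  gcongr
  linarith [hundred_le_scaleBase_real d]

theorem shrink_bounds (d n : ℕ) : 1 / 2 + (1 / 2) ^ (n + 1) ≤ shrink d n ∧ shrink d n ≤ 1 := by
  induction n with
  | zero => norm_num [shrink]
  | succ n ih =>
    have hB := scaleBase_mul_two_pow_le d n
    have hB1 := hundred_le_scaleBase_real d
    have h2 : (0 : ℝ) < 2 ^ n := by positivity
    have hK : ((scaleBase d : ℝ) ^ (n + 1))⁻¹ ≤ (1 / 2) ^ (n + 2) := by
      rw [one_div, inv_pow]
      refine inv_anti₀ (by positivity) ?_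
      rw [pow_add]
      nlinarith
    have hK0 : 0 ≤ ((scaleBase d : ℝ) ^ (n + 1))⁻¹ := by positivity
    have hp : (0 : ℝ) < (1 / 2) ^ (n + 1) := by positivity
    have hpp : ((1 : ℝ) / 2) ^ (n + 2) = (1 / 2) ^ (n + 1) / 2 := by rw [pow_succ]; ring
    simp only [shrink]
    constructor
    · rw [show n + 1 + 1 = n + 2 from rfl]
      nlinarith [ih.1, ih.2]
    · nlinarith [ih.1, ih.2]

theorem half_le_shrink (d n : ℕ) : 1 / 2 ≤ shrink d n := by
  have h := (shrink_bounds d n).1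
  have : (0 : ℝ) < (1 / 2) ^ (n + 1) := by positivity
  linarith

theorem shrink_pos (d n : ℕ) : 0 < shrink d n := by
  linarith [half_le_shrink d n]

theorem sideLen_pos (d n : ℕ) : 0 < sideLen d n := by
  have := shrink_pos d n
  have := hundred_le_scaleBase_real d
  unfold sideLen
  positivity

theorem sideExp_bounds {d : ℕ} (hd : 2 ≤ d) (n : ℕ) :
    n * (n + 1) ≤ sideExp d n ∧ sideExp d n ≤ 5 * n + d * n ^ 2 := by
  induction n with
  | zero => simp [sideExp]
  | succ n ih =>
    simp only [sideExp]
    constructor <;> nlinarith [ih.1, ih.2]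

theorem cubeCount_eq {d : ℕ} (hd : 2 ≤ d) (n : ℕ) :
    cubeCount d n = scaleBase d ^ ((d - 1) * sideExp d n + 5 * n) := by
  obtain ⟨e, rfl⟩ : ∃ e, d = e + 1 := ⟨d - 1, by omega⟩
  induction n with
  | zero => simp [cubeCount, sideExp]
  | succ n ih =>
    rw [cubeCount, ih, branching, ← pow_mul, ← pow_add, sideExp]
    congr 1
    simp only [Nat.add_sub_cancel]
    ring

theorem sideLen_zero (d : ℕ) : sideLen d 0 = 1 := by
  simp [sideLen, shrink, sideExp]

theorem branching_mul_pow {d : ℕ} (hd : 2 ≤ d) (n : ℕ) :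
    branching d n * scaleBase d ^ (n + 1) = scaleBase d ^ (5 + (n + 1) * d) := by
  obtain ⟨e, rfl⟩ : ∃ e, d = e + 1 := ⟨d - 1, by omega⟩
  rw [branching, ← pow_add]
  congr 1
  simp only [Nat.add_sub_cancel]
  ring

theorem sideLen_succ {d : ℕ} (hd : 2 ≤ d) (n : ℕ) :
    sideLen d (n + 1) = (1 - ((scaleBase d : ℝ) ^ (n + 1))⁻¹) *
      (sideLen d n / (branching d n * (scaleBase d : ℝ) ^ (n + 1))) := by
  have h : (branching d n : ℝ) * (scaleBase d : ℝ) ^ (n + 1) =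
      (scaleBase d : ℝ) ^ (5 + (n + 1) * d) := by exact_mod_cast branching_mul_pow hd n
  rw [h, sideLen, sideLen, shrink, sideExp, pow_add _ (sideExp d n)]
  ring

theorem sideLen_le (d n : ℕ) : sideLen d n ≤ ((scaleBase d : ℝ) ^ sideExp d n)⁻¹ := by
  have := hundred_le_scaleBase_real d
  rw [sideLen, div_eq_mul_inv]
  exact mul_le_of_le_one_left (by positivity) (shrink_bounds d n).2

theorem antitone_sideLen {d : ℕ} (hd : 2 ≤ d) : Antitone (sideLen d) := by
  refine antitone_nat_of_succ_le fun n => ?_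
  have hB := hundred_le_scaleBase_real d
  have h : (branching d n : ℝ) * (scaleBase d : ℝ) ^ (n + 1) =
      (scaleBase d : ℝ) ^ (5 + (n + 1) * d) := by exact_mod_cast branching_mul_pow hd n
  rw [sideLen_succ hd, h]
  have h1 : (1 : ℝ) ≤ (scaleBase d : ℝ) ^ (5 + (n + 1) * d) := one_le_pow₀ (by linarith)
  have h2 : sideLen d n / (scaleBase d : ℝ) ^ (5 + (n + 1) * d) ≤ sideLen d n :=
    div_le_self (sideLen_pos d n).le h1
  have h3 : 0 ≤ ((scaleBase d : ℝ) ^ (n + 1))⁻¹ := by positivity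
  have h4 : 0 ≤ sideLen d n / (scaleBase d : ℝ) ^ (5 + (n + 1) * d) :=
    div_nonneg (sideLen_pos d n).le (by positivity)
  nlinarith

theorem sideLen_le_inv {d : ℕ} (hd : 2 ≤ d) (n : ℕ) : sideLen d n ≤ ((n : ℝ) + 1)⁻¹ := by
  refine (sideLen_le d n).trans (inv_anti₀ (by positivity) ?_)
  rcases n.eq_zero_or_pos with rfl | hn
  · simp [sideExp]
  have h1 : n + 1 ≤ sideExp d n := by nlinarith [(sideExp_bounds hd n).1]
  have h2 : sideExp d n < scaleBase d ^ sideExp d n :=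
    Nat.lt_pow_self (by linarith [hundred_le_scaleBase d])
  exact_mod_cast h1.trans h2.le

theorem positions_add_four (d n : ℕ) : positions d n + 4 = scaleBase d ^ (n + 1) := by
  have h : scaleBase d ^ 1 ≤ scaleBase d ^ (n + 1) :=
    Nat.pow_le_pow_right (by linarith [hundred_le_scaleBase d]) (by omega)
  have := hundred_le_scaleBase d
  rw [pow_one] at h
  unfold positions
  omega

theorem positions_pos (d n : ℕ) : 0 < positions d n := by
  have h : scaleBase d ^ 1 ≤ scaleBase d ^ (n + 1) :=
    Nat.pow_le_pow_right (by linarith [hundred_le_scaleBase d]) (by omega)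
  have := hundred_le_scaleBase d
  rw [pow_one] at h
  unfold positions
  omega

theorem sectionBound_pos (d n : ℕ) : 0 < sectionBound d n := by
  have hB := hundred_le_scaleBase_real d
  induction n with
  | zero => simp [sectionBound]
  | succ n ih =>
    have := positions_pos d n
    rw [sectionBound]
    positivity

/-- The total volume of the cubes at stage `n`. -/
def stageVolume (d n : ℕ) : ℝ := cubeCount d n * sideLen d n ^ d

theorem cubeCount_pos (d n : ℕ) : 0 < cubeCount d n := by
  induction n with
  | zero => simp [cubeCount]
  | succ n ih =>
    have := hundred_le_scaleBase d
    rw [cubeCount, branching]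
    positivity

theorem stageVolume_pos (d n : ℕ) : 0 < stageVolume d n := by
  have := cubeCount_pos d n
  have := sideLen_pos d n
  unfold stageVolume
  positivity

theorem stageVolume_succ {d : ℕ} (hd : 2 ≤ d) (n : ℕ) :
    stageVolume d (n + 1) = stageVolume d n *
      ((1 - ((scaleBase d : ℝ) ^ (n + 1))⁻¹) * ((scaleBase d : ℝ) ^ (n + 1))⁻¹) ^ d := by
  have hB := hundred_le_scaleBase_real d
  have hL : (branching d n : ℝ) ≠ 0 := by
    rw [branching]
    push_cast
    positivity
  rw [stageVolume, stageVolume, sideLen_succ hd, cubeCount]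
  push_cast
  rw [mul_assoc, mul_assoc, ← mul_pow, ← mul_pow]
  congr 2
  field_simp

theorem sectionBound_bounds {d : ℕ} (hd : 2 ≤ d) (n : ℕ) :
    stageVolume d n ≤ sectionBound d n ∧
      sectionBound d n ≤ (2 - (1 / 2) ^ n) * stageVolume d n := by
  induction n with
  | zero => norm_num [stageVolume, sectionBound, cubeCount, sideLen_zero]
  | succ n ih =>
    have hV := stageVolume_pos d n
    have hH := sectionBound_pos d n
    have hBn := scaleBase_mul_two_pow_le d n
    have hB1 := hundred_le_scaleBase_real d
    have hBd : (100 : ℝ) * d ^ 2 ≤ scaleBase d := by exact_mod_cast mul_sq_le_scaleBase d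
    have hd' : (2 : ℝ) ≤ d := by exact_mod_cast hd
    have hM : (positions d n : ℝ) = (scaleBase d : ℝ) ^ (n + 1) - 4 := by
      rw [eq_sub_iff_add_eq]
      exact_mod_cast positions_add_four d n
    have hM0 : (0 : ℝ) < positions d n := by exact_mod_cast positions_pos d n
    have h2n : (1 : ℝ) ≤ 2 ^ n := one_le_pow₀ (by norm_num)
    set K : ℝ := (scaleBase d : ℝ) ^ (n + 1) with hK
    have hK100 : 100 ≤ K := by nlinarith
    have hKd : 50 * d * 2 ^ n ≤ K := by
      have : (50 : ℝ) * d ≤ scaleBase d := by nlinarith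
      nlinarith
    have hx : K⁻¹ ≤ 1 / 100 := by
      rw [one_div]
      exact inv_anti₀ (by norm_num) hK100
    have hx0 : 0 < K⁻¹ := by positivity
    have hxK : K⁻¹ * K = 1 := inv_mul_cancel₀ (by positivity)
    rw [stageVolume_succ hd, sectionBound, ← hK]
    have hden : (positions d n : ℝ) ^ d = ((1 - 4 * K⁻¹) * K) ^ d := by
      rw [hM]; congr 1; linear_combination (4 : ℝ) * hxK
    have hb : (1 - 5 * (d : ℝ) * K⁻¹) ≤ ((1 - 4 * K⁻¹) * (1 - K⁻¹)) ^ d := by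
      calc (1 - 5 * (d : ℝ) * K⁻¹) = 1 + d * (-5 * K⁻¹) := by ring
        _ ≤ (1 + (-5 * K⁻¹)) ^ d := one_add_mul_le_pow (by linarith) d
        _ ≤ _ := by
          refine pow_le_pow_left₀ (by linarith) ?_ d
          nlinarith [sq_nonneg K⁻¹]
    have hb1 : ((1 - 4 * K⁻¹) * (1 - K⁻¹)) ^ d ≤ 1 :=
      pow_le_one₀ (mul_nonneg (by linarith) (by linarith)) (by nlinarith)
    set θ : ℝ := ((1 - 4 * K⁻¹) * (1 - K⁻¹)) ^ d with hθ
    have hpos : 0 < (positions d n : ℝ) ^ d := by positivity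
    have hkey : ((1 - K⁻¹) * K⁻¹) ^ d * (positions d n : ℝ) ^ d = θ := by
      rw [hden, ← mul_pow, hθ]
      congr 1
      linear_combination ((1 - K⁻¹) * (1 - 4 * K⁻¹)) * hxK
    have hdx : (d : ℝ) * K⁻¹ ≤ 1 / 50 * (1 / 2) ^ n := by
      rw [← div_eq_mul_inv, div_le_iff₀ (by positivity), one_div_pow]
      rw [show 1 / 50 * (1 / 2 ^ n) * K = K / (50 * 2 ^ n) by field_simp,
        le_div_iff₀ (by positivity)]
      linarith
    have hp0 : (0 : ℝ) < (1 / 2) ^ n := by positivity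
    have hp1 : ((1 : ℝ) / 2) ^ n ≤ 1 := pow_le_one₀ (by norm_num) (by norm_num)
    have hps : ((1 : ℝ) / 2) ^ (n + 1) = (1 / 2) ^ n / 2 := by rw [pow_succ]; ring
    constructor
    · rw [le_div_iff₀ hpos, mul_assoc, hkey]
      nlinarith [ih.1]
    · rw [div_le_iff₀ hpos, mul_assoc, mul_assoc, hkey, hps]
      set p : ℝ := (1 / 2) ^ n with hp
      have hxd : K⁻¹ ≤ 1 / 100 * p := by nlinarith
      have hq : (1 + 2 * K⁻¹) * (2 - p) ≤ (2 - p / 2) * θ := by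
        have h1 : (2 - p / 2) * (1 - 5 * (d : ℝ) * K⁻¹) ≤ (2 - p / 2) * θ := by gcongr; linarith
        nlinarith
      calc (1 + 2 * K⁻¹) * sectionBound d n
          ≤ (1 + 2 * K⁻¹) * ((2 - p) * stageVolume d n) := by gcongr; exact ih.2
        _ = (1 + 2 * K⁻¹) * (2 - p) * stageVolume d n := by ring
        _ ≤ (2 - p / 2) * θ * stageVolume d n := by gcongr
        _ = _ := by ring

theorem cubeCount_mul_sideLen_pow {d : ℕ} (hd : 2 ≤ d) (n : ℕ) :
    cubeCount d n * sideLen d n ^ (d - 1) =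
      (scaleBase d : ℝ) ^ (5 * n) * shrink d n ^ (d - 1) := by
  have hB := hundred_le_scaleBase_real d
  rw [cubeCount_eq hd, sideLen, div_pow, ← pow_mul]
  push_cast
  rw [pow_add, mul_comm (sideExp d n)]
  field_simp

theorem pow_le_concentration_exponent {d : ℕ} (hd : 2 ≤ d) (n : ℕ) :
    (scaleBase d : ℝ) ^ (2 * (n + 1)) ≤
      ((scaleBase d : ℝ) ^ (n + 1))⁻¹ * (((scaleBase d : ℝ) ^ (n + 1))⁻¹ * sectionBound d n /
        (positions d n : ℝ) ^ d) / (sideLen d n / (branching d n * (scaleBase d : ℝ) ^ (n + 1))) := by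
  have hB := hundred_le_scaleBase_real d
  have hs := sideLen_pos d n
  have hM0 : (0 : ℝ) < positions d n := by exact_mod_cast positions_pos d n
  have hMK : (positions d n : ℝ) ≤ (scaleBase d : ℝ) ^ (n + 1) := by
    exact_mod_cast (Nat.le_add_right _ 4).trans (positions_add_four d n).le
  have hLK : (branching d n : ℝ) * (scaleBase d : ℝ) ^ (n + 1) =
      (scaleBase d : ℝ) ^ 5 * ((scaleBase d : ℝ) ^ (n + 1)) ^ d := by
    rw [← pow_mul, ← pow_add]
    exact_mod_cast branching_mul_pow hd n
  have hH := (sectionBound_bounds hd n).1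
  have hsd : sideLen d n ^ d = sideLen d n ^ (d - 1) * sideLen d n := by
    rw [← pow_succ]; congr 1; omega
  have hσ : ((scaleBase d : ℝ))⁻¹ ≤ shrink d n ^ (d - 1) := by
    calc ((scaleBase d : ℝ))⁻¹ ≤ ((2 : ℝ) ^ d)⁻¹ :=
          inv_anti₀ (by positivity) (by exact_mod_cast two_pow_le_scaleBase d)
      _ = (1 / 2) ^ d := by rw [one_div, inv_pow]
      _ ≤ (1 / 2) ^ (d - 1) := pow_le_pow_of_le_one (by norm_num) (by norm_num) (by omega)
      _ ≤ _ := pow_le_pow_left₀ (by norm_num) (half_le_shrink d n) _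
  have hV : stageVolume d n / sideLen d n = (scaleBase d : ℝ) ^ (5 * n) * shrink d n ^ (d - 1) := by
    rw [← cubeCount_mul_sideLen_pow hd, stageVolume, hsd]
    field_simp
  rw [hLK]
  set B := (scaleBase d : ℝ) with hBdef
  have hK0 : 0 < B ^ (n + 1) := by positivity
  calc B ^ (2 * (n + 1)) ≤ B ^ (3 * n + 2) := pow_le_pow_right₀ (by linarith) (by omega)
    _ = B ^ (5 * n) * B⁻¹ * B ^ 5 * ((B ^ (n + 1))⁻¹ * (B ^ (n + 1))⁻¹) := by
        field_simp
        ring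
    _ ≤ stageVolume d n / sideLen d n * B ^ 5 * ((B ^ (n + 1))⁻¹ * (B ^ (n + 1))⁻¹) := by
        rw [hV]
        gcongr
    _ ≤ sectionBound d n / sideLen d n * B ^ 5 * ((B ^ (n + 1))⁻¹ * (B ^ (n + 1))⁻¹) := by
        gcongr
    _ = (B ^ (n + 1))⁻¹ * ((B ^ (n + 1))⁻¹ * sectionBound d n / (B ^ (n + 1)) ^ d) /
        (sideLen d n / (B ^ 5 * (B ^ (n + 1)) ^ d)) := by
        field_simp
    _ ≤ _ := by
        have := sectionBound_pos d n
        gcongr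

/-- The fineness of the net of lines used at stage `n`. -/
def fineness (d n : ℕ) : ℕ := scaleBase d ^ (n + 2 + sideExp d (n + 1))

theorem four_div_le_fineness {d : ℕ} (hd : 2 ≤ d) (n : ℕ) :
    4 / (((scaleBase d : ℝ) ^ (n + 1))⁻¹ *
      (sideLen d n / (branching d n * (scaleBase d : ℝ) ^ (n + 1)))) ≤ fineness d n := by
  have hB := hundred_le_scaleBase_real d
  have hσ := half_le_shrink d n
  have hσ0 := shrink_pos d n
  have hLK : (branching d n : ℝ) * (scaleBase d : ℝ) ^ (n + 1) =
      (scaleBase d : ℝ) ^ (5 + (n + 1) * d) := by exact_mod_cast branching_mul_pow hd n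
  rw [hLK, sideLen, fineness, sideExp]
  push_cast
  set B := (scaleBase d : ℝ)
  have hB0 : 0 < B := by linarith
  have h8 : 4 / shrink d n ≤ B := by
    rw [div_le_iff₀ hσ0]
    nlinarith
  calc 4 / ((B ^ (n + 1))⁻¹ * (shrink d n / B ^ sideExp d n / B ^ (5 + (n + 1) * d)))
      = 4 / shrink d n * (B ^ (n + 1) * B ^ sideExp d n * B ^ (5 + (n + 1) * d)) := by
        field_simp
    _ ≤ B * (B ^ (n + 1) * B ^ sideExp d n * B ^ (5 + (n + 1) * d)) := by gcongr
    _ = B ^ (n + 2 + (sideExp d n + (5 + (n + 1) * d))) := by ring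

theorem fineness_exponent_le {d : ℕ} (hd : 2 ≤ d) (n : ℕ) :
    scaleBase d * ((1 + 2 * (n + 2 + sideExp d (n + 1))) * d) ≤ scaleBase d ^ (2 * (n + 1)) := by
  have hB := mul_sq_le_scaleBase d
  have hB1 := hundred_le_scaleBase d
  have hP := (sideExp_bounds hd (n + 1)).2
  have hn : n + 1 ≤ scaleBase d ^ n := Nat.lt_pow_self (by omega)
  have h1 : (1 + 2 * (n + 2 + sideExp d (n + 1))) * d ≤ scaleBase d * (n + 1) ^ 2 := by
    calc (1 + 2 * (n + 2 + sideExp d (n + 1))) * d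
        ≤ (1 + 2 * (n + 2 + (5 * (n + 1) + d * (n + 1) ^ 2))) * d := by gcongr
      _ ≤ 100 * d ^ 2 * (n + 1) ^ 2 := by
        have h2 : (1 + 2 * (n + 2 + (5 * (n + 1) + d * (n + 1) ^ 2))) ≤ 100 * d * (n + 1) ^ 2 := by
          nlinarith [Nat.zero_le n, Nat.zero_le (n ^ 2), mul_le_mul hd (le_refl ((n + 1) ^ 2))
            (Nat.zero_le _) (Nat.zero_le _)]
        nlinarith
      _ ≤ _ := by gcongr
  calc scaleBase d * ((1 + 2 * (n + 2 + sideExp d (n + 1))) * d)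
      ≤ scaleBase d * (scaleBase d * (n + 1) ^ 2) := by gcongr
    _ ≤ scaleBase d * (scaleBase d * (scaleBase d ^ n) ^ 2) := by gcongr
    _ = _ := by ring

theorem net_mul_exp_lt_one {d : ℕ} (hd : 2 ≤ d) (n : ℕ) {x : ℝ}
    (hx : (scaleBase d : ℝ) ^ (2 * (n + 1)) ≤ x) :
    (((fineness d n + 1) * (2 * fineness d n + 1) : ℕ) : ℝ) ^ d * Real.exp (-x) < 1 := by
  have hB1 := hundred_le_scaleBase d
  have hm : 1 ≤ fineness d n := Nat.one_le_pow _ _ (by omega)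
  set e := (1 + 2 * (n + 2 + sideExp d (n + 1))) * d with he
  have he0 : e ≠ 0 := by
    rw [he]
    exact Nat.mul_ne_zero (by omega) (by omega)
  have h1 : (fineness d n + 1) * (2 * fineness d n + 1) ≤
      scaleBase d ^ (1 + 2 * (n + 2 + sideExp d (n + 1))) := by
    have : scaleBase d ^ (1 + 2 * (n + 2 + sideExp d (n + 1))) =
        scaleBase d * fineness d n ^ 2 := by
      rw [fineness]; ring
    rw [this]
    nlinarith
  have h2 : (((fineness d n + 1) * (2 * fineness d n + 1) : ℕ) : ℝ) ^ d ≤ (scaleBase d : ℝ) ^ e := by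
    rw [he, pow_mul]
    refine pow_le_pow_left₀ (Nat.cast_nonneg _) ?_ d
    exact_mod_cast h1
  have h3 : (scaleBase d : ℝ) ^ e < Real.exp x := by
    calc (scaleBase d : ℝ) ^ e < Real.exp (scaleBase d) ^ e := by
          refine pow_lt_pow_left₀ ?_ (Nat.cast_nonneg _) he0
          linarith [Real.add_one_le_exp (scaleBase d : ℝ)]
      _ = Real.exp (e * scaleBase d) := (Real.exp_nat_mul _ _).symm
      _ ≤ Real.exp x := by
          refine Real.exp_le_exp.2 (le_trans ?_ hx)
          rw [mul_comm]
          exact_mod_cast fineness_exponent_le hd n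
  rw [Real.exp_neg, ← div_eq_mul_inv, div_lt_one (Real.exp_pos _)]
  exact h2.trans_lt h3

/-- A family of cubes satisfying the requirements of stage `n`. -/
structure IsStage (d n : ℕ) (C : Finset (Fin d → ℝ)) : Prop where
  card_eq : C.card = cubeCount d n
  subset_Icc : cubeUnion C (sideLen d n) ⊆ Icc 0 1
  disjoint : ∀ c ∈ C, ∀ c' ∈ C, ∀ x ∈ closedCube c (sideLen d n),
    x ∈ closedCube c' (sideLen d n) → c = c'
  volume_lineTrace_le : ∀ a v : Fin d → ℝ, ‖v‖ = 1 →
    volume (lineTrace a v (cubeUnion C (sideLen d n))) ≤ ENNReal.ofReal (sectionBound d n)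

theorem isStage_zero (d : ℕ) : IsStage d 0 {0} := by
  have hU : cubeUnion ({0} : Finset (Fin d → ℝ)) (sideLen d 0) = closedCube 0 1 := by
    ext x
    simp [mem_cubeUnion, sideLen_zero]
  refine ⟨by simp [cubeCount], ?_, ?_, fun a v hv => ?_⟩
  · rw [hU, closedCube_eq_pi]
    intro x hx
    simp only [mem_pi, mem_univ, forall_const, Pi.zero_apply, zero_add, mem_Icc] at hx
    exact ⟨fun i => (hx i).1, fun i => (hx i).2⟩
  · intro c hc c' hc' _ _ _
    rw [Finset.mem_singleton.1 hc, Finset.mem_singleton.1 hc']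
  · rw [hU]
    exact volume_lineTrace_closedCube_le a 0 hv 1

/-- The gap scale between stages `n` and `n + 1`. -/
def gapScale (d n : ℕ) : ℝ := sideLen d n / (branching d n * (scaleBase d : ℝ) ^ (n + 1))

theorem gapScale_pos (d n : ℕ) : 0 < gapScale d n := by
  have := hundred_le_scaleBase_real d
  have hL : (0 : ℝ) < branching d n := by
    rw [branching]
    push_cast
    positivity
  have := sideLen_pos d n
  unfold gapScale
  positivity

theorem gapScale_le {d : ℕ} (n : ℕ) : gapScale d n ≤ sideLen d n := by
  have hB := hundred_le_scaleBase_real d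
  have hL : (1 : ℝ) ≤ branching d n := by
    rw [branching]
    push_cast
    exact one_le_pow₀ (by linarith)
  refine div_le_self (sideLen_pos d n).le (one_le_mul_of_one_le_of_one_le hL ?_)
  exact one_le_pow₀ (by linarith)

theorem IsStage.exists_succ {d n : ℕ} (hd : 2 ≤ d) {C : Finset (Fin d → ℝ)} (hC : IsStage d n C) :
    ∃ C' : Finset (Fin d → ℝ), IsStage d (n + 1) C' ∧
      cubeUnion C' (sideLen d (n + 1)) ⊆ cubeUnion C (sideLen d n) ∧
      ∀ x ∈ cubeUnion C' (sideLen d (n + 1)), ∀ y ∈ cubeUnion C' (sideLen d (n + 1)),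
        ‖y - x‖ ≤ 2 * gapScale d n → ‖y - x‖ ≤ gapScale d n := by
  have hB := hundred_le_scaleBase_real d
  have hK : (1 : ℝ) < (scaleBase d : ℝ) ^ (n + 1) := one_lt_pow₀ (by linarith) (by omega)
  have hK1 := inv_lt_one_of_one_lt₀ hK
  have hK0 : 0 < ((scaleBase d : ℝ) ^ (n + 1))⁻¹ := by positivity
  have hL : (branching d n : ℝ) ≠ 0 := by
    rw [branching]
    push_cast
    positivity
  obtain ⟨C', hcard, hsub, hdisj, hline, hgap⟩ := exists_refinement
    (κ := ((scaleBase d : ℝ) ^ (n + 1))⁻¹) (δ := ((scaleBase d : ℝ) ^ (n + 1))⁻¹)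
    (u := gapScale d n) (L := branching d n)
    (t := ((scaleBase d : ℝ) ^ (n + 1))⁻¹ * sectionBound d n / (positions d n : ℝ) ^ d)
    (positions_pos d n) (Nat.one_le_pow _ _ (by linarith [hundred_le_scaleBase d]))
    (gapScale_pos d n) (by
      rw [positions_add_four, gapScale]
      push_cast
      field_simp) hK0 hK1 hK0 hK1.le (sectionBound_pos d n).le hC.subset_Icc hC.disjoint
    hC.volume_lineTrace_le (four_div_le_fineness hd n)
    (net_mul_exp_lt_one hd n (pow_le_concentration_exponent hd n))
  have hs : sideLen d (n + 1) = (1 - ((scaleBase d : ℝ) ^ (n + 1))⁻¹) * gapScale d n :=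
    sideLen_succ hd n
  rw [← hs] at hsub hdisj hline hgap
  refine ⟨C', ⟨?_, hsub.trans hC.subset_Icc, hdisj, fun a v hv => (hline a v hv).trans_eq ?_⟩,
    hsub, hgap⟩
  · rw [hcard, hC.card_eq, cubeCount]
  · congr 1
    rw [sectionBound]
    ring

theorem exists_stage_seq {d : ℕ} (hd : 2 ≤ d) : ∃ C : ℕ → Finset (Fin d → ℝ),
    (∀ n, IsStage d n (C n)) ∧
    (∀ n, cubeUnion (C (n + 1)) (sideLen d (n + 1)) ⊆ cubeUnion (C n) (sideLen d n)) ∧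
    ∀ n, ∀ x ∈ cubeUnion (C (n + 1)) (sideLen d (n + 1)),
      ∀ y ∈ cubeUnion (C (n + 1)) (sideLen d (n + 1)),
        ‖y - x‖ ≤ 2 * gapScale d n → ‖y - x‖ ≤ gapScale d n := by
  choose! next hnext using fun (n : ℕ) (C : Finset (Fin d → ℝ)) (hC : IsStage d n C) =>
    hC.exists_succ hd
  let C : ℕ → Finset (Fin d → ℝ) := fun n => Nat.rec {0} next n
  have hC : ∀ n, IsStage d n (C n) := by
    intro n
    induction n with
    | zero => exact isStage_zero d
    | succ n ih => exact (hnext n _ ih).1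
  exact ⟨C, hC, fun n => (hnext n _ (hC n)).2.1, fun n => (hnext n _ (hC n)).2.2⟩

theorem IsStage.stageVolume_le {d n : ℕ} {C : Finset (Fin d → ℝ)} (hC : IsStage d n C) :
    ENNReal.ofReal (stageVolume d n) ≤ volume (cubeUnion C (sideLen d n)) := by
  have hU : cubeUnion C (sideLen d n) = ⋃ c ∈ C, closedCube c (sideLen d n) := by
    ext x
    simp [mem_cubeUnion]
  rw [hU, measure_biUnion_finset]
  · rw [Finset.sum_congr rfl fun c _ => volume_closedCube c, Finset.sum_const, hC.card_eq,
      nsmul_eq_mul, stageVolume, ENNReal.ofReal_mul (Nat.cast_nonneg _), ENNReal.ofReal_natCast,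
      ENNReal.ofReal_pow (sideLen_pos d n).le]
  · intro c hc c' hc' hne
    exact disjoint_left.2 fun x hx hx' => hne (hC.disjoint c hc c' hc' x hx hx')
  · exact fun c _ => (isCompact_closedCube c _).isClosed.measurableSet

theorem cubeCount_succ_le {d : ℕ} (hd : 2 ≤ d) {ε : ℝ} (hε : 0 < ε) {n : ℕ}
    (hn : (((d - 1) * (6 + d) + 5 : ℕ) : ℝ) / ε + 1 ≤ n) {r : ℝ} (hr0 : 0 < r)
    (hr : r < d * sideLen d n) :
    (cubeCount d (n + 1) : ℝ) ≤ r ^ (-((d : ℝ) - 1 + ε)) := by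
  have hB := hundred_le_scaleBase_real d
  have hd' : (2 : ℝ) ≤ d := by exact_mod_cast hd
  have hdB : (d : ℝ) ≤ scaleBase d := by
    have : (100 : ℝ) * d ^ 2 ≤ scaleBase d := by exact_mod_cast mul_sq_le_scaleBase d
    nlinarith
  set B := (scaleBase d : ℝ) with hBdef
  set P := (sideExp d n : ℝ) with hP
  have hB0 : 0 < B := by linarith
  have hrB : r ≤ B ^ (-(P - 1)) := by
    rw [neg_sub, Real.rpow_sub hB0, Real.rpow_one, hP, Real.rpow_natCast, div_eq_mul_inv]
    refine hr.le.trans ?_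
    have := sideLen_pos d n
    exact mul_le_mul hdB (sideLen_le d n) this.le hB0.le
  have hn1 : 1 ≤ (n : ℝ) := le_trans (by
    have : (0 : ℝ) ≤ (((d - 1) * (6 + d) + 5 : ℕ) : ℝ) / ε := by positivity
    linarith) hn
  have hPn : (n : ℝ) * (n + 1) ≤ P := by
    rw [hP]
    exact_mod_cast (sideExp_bounds hd n).1
  have hCε : (((d - 1) * (6 + d) + 5 : ℕ) : ℝ) ≤ ((n : ℝ) - 1) * ε := by
    rw [← div_le_iff₀ hε]
    linarith
  have hcast : ((d - 1 : ℕ) : ℝ) = (d : ℝ) - 1 := by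
    rw [Nat.cast_sub (by omega), Nat.cast_one]
  push_cast [hcast] at hCε
  have hexp : (((d - 1) * sideExp d (n + 1) + 5 * (n + 1) : ℕ) : ℝ) ≤
      (P - 1) * ((d : ℝ) - 1 + ε) := by
    rw [sideExp]
    push_cast [hcast]
    rw [← hP]
    have h1 : ((n : ℝ) - 1) * (n + 1) * ε ≤ (P - 1) * ε := by gcongr; nlinarith
    have h2 : (((d : ℝ) - 1) * (6 + d) + 5) * (n + 1) ≤ ((n : ℝ) - 1) * ε * (n + 1) := by gcongr
    nlinarith [mul_nonneg (mul_nonneg (by linarith : (0 : ℝ) ≤ n) (by linarith : (0 : ℝ) ≤ d))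
      (by linarith : (0 : ℝ) ≤ d), mul_nonneg (by linarith : (0 : ℝ) ≤ n)
      (by linarith : (0 : ℝ) ≤ (d : ℝ) - 1)]
  calc (cubeCount d (n + 1) : ℝ)
      = B ^ ((((d - 1) * sideExp d (n + 1) + 5 * (n + 1) : ℕ) : ℝ)) := by
        rw [cubeCount_eq hd, Real.rpow_natCast]
        push_cast
        rfl
    _ ≤ B ^ ((P - 1) * ((d : ℝ) - 1 + ε)) :=
        Real.rpow_le_rpow_of_exponent_le (by linarith) hexp
    _ = (B ^ (-(P - 1))) ^ (-((d : ℝ) - 1 + ε)) := by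
        rw [← Real.rpow_mul hB0.le]
        congr 1
        ring
    _ ≤ r ^ (-((d : ℝ) - 1 + ε)) :=
        Real.rpow_le_rpow_of_nonpos hr0 hrB (by linarith)

/-- A set in Euclidean space whose image in the sup norm has null intersection with every Lipschitz
curve has itself null intersection with every Lipschitz curve. -/
theorem hausdorffMeasure_inter_image_eq_zero_of_ofLp {d : ℕ} {A : Set (Fin d → ℝ)}
    (hA : ∀ (K : ℝ≥0) (g : ℝ → Fin d → ℝ), LipschitzWith K g → μH[1] (A ∩ g '' Icc 0 1) = 0)
    {K : ℝ≥0} {f : ℝ → Pt d} (hf : LipschitzOnWith K f (Icc 0 1)) :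
    μH[1] (WithLp.ofLp ⁻¹' A ∩ f '' Icc 0 1) = 0 := by
  let g : ℝ → Fin d → ℝ := fun t => WithLp.ofLp (f (projIcc 0 1 zero_le_one t))
  have hg : LipschitzWith (1 * (K * 1)) g :=
    (PiLp.lipschitzWith_ofLp 2 fun _ : Fin d => ℝ).comp
      (hf.to_restrict.comp (LipschitzWith.projIcc zero_le_one))
  have hsub : WithLp.ofLp ⁻¹' A ∩ f '' Icc 0 1 ⊆ WithLp.toLp 2 '' (A ∩ g '' Icc 0 1) := by
    rintro _ ⟨hx, t, ht, rfl⟩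
    refine ⟨WithLp.ofLp (f t), ⟨hx, t, ht, ?_⟩, rfl⟩
    simp only [g, projIcc_of_mem zero_le_one ht]
  refine measure_mono_null hsub ?_
  have h := (PiLp.lipschitzWith_toLp 2 fun _ : Fin d => ℝ).hausdorffMeasure_image_le
    zero_le_one (A ∩ g '' Icc 0 1)
  rw [hA _ g hg, mul_zero] at h
  exact le_antisymm h bot_le

theorem dist_toLp_le_of_mem_closedCube {d : ℕ} {c x : Fin d → ℝ} {h : ℝ} (hh : 0 ≤ h)
    (hx : x ∈ closedCube c h) : dist (WithLp.toLp 2 x) (WithLp.toLp 2 c : Pt d) ≤ d * h := by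
  rw [closedCube_eq_pi] at hx
  rw [EuclideanSpace.dist_eq]
  refine Real.sqrt_le_iff.2 ⟨by positivity, ?_⟩
  calc ∑ i, dist (x i) (c i) ^ 2 ≤ ∑ _i : Fin d, h ^ 2 := by
        refine Finset.sum_le_sum fun i _ => ?_
        have := hx i (mem_univ i)
        rw [Real.dist_eq, sq_abs]
        refine pow_le_pow_left₀ ?_ ?_ 2 <;> linarith [this.1, this.2]
    _ = d * h ^ 2 := by simp
    _ ≤ (d * h) ^ 2 := by
        rcases d.eq_zero_or_pos with rfl | hd
        · simp
        · have : (1 : ℝ) ≤ d := by exact_mod_cast hd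
          rw [mul_pow]
          gcongr
          nlinarith

theorem IsStage.exists_cover {d n : ℕ} {C : Finset (Fin d → ℝ)} (hC : IsStage d n C) {r : ℝ}
    (hr : d * sideLen d n ≤ r) : ∃ F : Finset (Pt d),
      (WithLp.ofLp ⁻¹' cubeUnion C (sideLen d n) ⊆ ⋃ x ∈ F, closedBall x r) ∧
        F.card ≤ cubeCount d n := by
  classical
  refine ⟨C.image (WithLp.toLp 2), fun x hx => ?_, Finset.card_image_le.trans hC.card_eq.le⟩
  obtain ⟨c, hc, hxc⟩ := mem_cubeUnion.1 hx
  refine mem_iUnion₂.2 ⟨_, Finset.mem_image_of_mem _ hc, mem_closedBall.2 (le_trans ?_ hr)⟩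
  exact dist_toLp_le_of_mem_closedCube (sideLen_pos d n).le hxc

theorem exists_sideLen_between {d : ℕ} (hd : 2 ≤ d) {r : ℝ} (hr : 0 < r) {n₀ : ℕ}
    (hrn : r < d * sideLen d n₀) :
    ∃ n, n₀ ≤ n ∧ d * sideLen d (n + 1) ≤ r ∧ r < d * sideLen d n := by
  classical
  have hd0 : (0 : ℝ) < d := by exact_mod_cast (by omega : 0 < d)
  have hex : ∃ n, d * sideLen d n ≤ r := by
    obtain ⟨n, hn⟩ := exists_nat_gt (d / r)
    refine ⟨n, ?_⟩
    calc d * sideLen d n ≤ d * ((n : ℝ) + 1)⁻¹ := by gcongr; exact sideLen_le_inv hd n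
      _ ≤ r := by
        rw [div_lt_iff₀ hr] at hn
        rw [← div_eq_mul_inv, div_le_iff₀ (by positivity)]
        nlinarith
  have hspec := Nat.find_spec hex
  have hlt : n₀ < Nat.find hex := by
    by_contra! h
    have := antitone_sideLen hd h
    have : d * sideLen d n₀ ≤ d * sideLen d (Nat.find hex) := by gcongr
    linarith
  obtain ⟨n, hn⟩ : ∃ n, Nat.find hex = n + 1 := ⟨Nat.find hex - 1, by omega⟩
  rw [hn] at hspec hlt
  exact ⟨n, by omega, hspec, not_le.1 (Nat.find_min hex (by omega))⟩

theorem exists_finset_cover {d : ℕ} (hd : 2 ≤ d) {C : ℕ → Finset (Fin d → ℝ)}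
    (hC : ∀ n, IsStage d n (C n)) {ε : ℝ} (hε : 0 < ε) :
    ∃ r₀ : ℝ, 0 < r₀ ∧ ∀ r : ℝ, 0 < r → r < r₀ → ∃ F : Finset (Pt d),
      (WithLp.ofLp ⁻¹' (⋂ n, cubeUnion (C n) (sideLen d n)) ⊆ ⋃ x ∈ F, closedBall x r) ∧
      (F.card : ℝ) ≤ r ^ (-((d : ℝ) - 1 + ε)) := by
  have hd0 : (0 : ℝ) < d := by exact_mod_cast (by omega : 0 < d)
  obtain ⟨n₀, hn₀⟩ := exists_nat_ge ((((d - 1) * (6 + d) + 5 : ℕ) : ℝ) / ε + 1)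
  refine ⟨d * sideLen d n₀, mul_pos hd0 (sideLen_pos d n₀), fun r hr0 hr => ?_⟩
  obtain ⟨n, hn, hle, hlt⟩ := exists_sideLen_between hd hr0 hr
  obtain ⟨F, hF, hcard⟩ := (hC (n + 1)).exists_cover hle
  refine ⟨F, (preimage_mono (iInter_subset _ (n + 1))).trans hF, ?_⟩
  have hn' : (n₀ : ℝ) ≤ n := by exact_mod_cast hn
  exact le_trans (by exact_mod_cast hcard) (cubeCount_succ_le hd hε (hn₀.trans hn') hr0 hlt)

theorem statement0 (d : ℕ) (hd : 2 ≤ d) :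
    ∃ A : Set (Pt d), IsCompact A ∧
      (∀ (K : ℝ≥0) (f : ℝ → Pt d), LipschitzOnWith K f (Set.Icc 0 1) →
        μH[1] (A ∩ f '' Set.Icc 0 1) = 0) ∧
      dimH A = (d : ℝ≥0∞) - 1 ∧
      (∀ ε : ℝ, 0 < ε → ∃ r₀ : ℝ, 0 < r₀ ∧ ∀ r : ℝ, 0 < r → r < r₀ →
        ∃ F : Finset (Pt d), (A ⊆ ⋃ x ∈ F, Metric.closedBall x r) ∧
          (F.card : ℝ) ≤ r ^ (-((d : ℝ) - 1 + ε))) ∧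
      ¬ TubeNull d A := by
  obtain ⟨C, hC, hanti, hgap⟩ := exists_stage_seq hd
  set E : ℕ → Set (Fin d → ℝ) := fun n => cubeUnion (C n) (sideLen d n) with hE
  have hcomp : ∀ n, IsCompact (E n) := fun n => isCompact_cubeUnion _ _
  have hclosed : IsClosed (⋂ n, E n) := isClosed_iInter fun n => (hcomp n).isClosed
  have hcompI : IsCompact (⋂ n, E n) := (hcomp 0).of_isClosed_subset hclosed (iInter_subset _ 0)
  have hnull : ¬ TubeNull d (WithLp.ofLp ⁻¹' ⋂ n, E n) := by
    refine not_tubeNull_of_volume_lineTrace_le hcomp (antitone_nat_of_succ_le hanti)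
      (hC 0).subset_Icc (V := fun n => ENNReal.ofReal (stageVolume d n))
      (fun n => (ENNReal.ofReal_pos.2 (stageVolume_pos d n)).ne') (fun n => ENNReal.ofReal_ne_top)
      (fun n => (hC n).stageVolume_le) fun n a v hv => ?_
    refine ((hC n).volume_lineTrace_le a v hv).trans ?_
    rw [← ENNReal.ofReal_ofNat 2, ← ENNReal.ofReal_mul (by norm_num)]
    refine ENNReal.ofReal_le_ofReal ((sectionBound_bounds hd n).2.trans ?_)
    have : (0 : ℝ) < (1 / 2) ^ n := by positivity
    nlinarith [stageVolume_pos d n]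
  have hcover : ∀ ε : ℝ, 0 < ε → _ := fun ε hε => exists_finset_cover hd hC hε
  refine ⟨WithLp.ofLp ⁻¹' ⋂ n, E n, ?_, fun K f hf => ?_, le_antisymm ?_ ?_, hcover, hnull⟩
  · exact (PiLp.homeomorph 2 fun _ : Fin d => ℝ).isCompact_preimage.2 hcompI
  · refine hausdorffMeasure_inter_image_eq_zero_of_ofLp (fun K g hg => ?_) hf
    refine hausdorffMeasure_inter_image_eq_zero_of_annuli hclosed (fun ε hε => ?_) hg
    obtain ⟨n, hn⟩ := exists_nat_gt ε⁻¹
    refine ⟨gapScale d n, gapScale_pos d n, ?_, fun x hx y hy =>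
      hgap n x (mem_iInter.1 hx _) y (mem_iInter.1 hy _)⟩
    calc gapScale d n ≤ ((n : ℝ) + 1)⁻¹ := (gapScale_le n).trans (sideLen_le_inv hd n)
      _ < ε := by
        rw [inv_lt_comm₀ (by positivity) hε]
        linarith
  · have hd1 : (1 : ℝ) ≤ d := by exact_mod_cast (by omega : 1 ≤ d)
    refine (dimH_le_of_forall_exists_card_le (D := (d : ℝ) - 1) (by linarith) hcover).trans_eq ?_
    rw [ENNReal.ofReal_sub _ zero_le_one, ENNReal.ofReal_natCast, ENNReal.ofReal_one]
  · by_contra! h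
    refine hnull (tubeNull_of_dimH_lt hd ?_)
    rwa [ENNReal.natCast_sub, Nat.cast_one]
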